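/- arXiv:2412.16517 — 3 statements merged into one kernel-verified Lean document; each statement's English description precedes it below -/
import Mathlib

section
/- Let a and b be relatively prime positive integers with a/b < 1, and let q ≥ 2 be an integer satisfying q > 2·log b / (log b − log a). Then the real number V_q(a/b) = ∑_{n≥1} ν_q(n)·(a/b)^n is transcendental over ℚ. -/
open Filter Topology

lemma nu_mul (q m : ℕ) (hq : 2 ≤ q) (hm : m ≠ 0) :
    padicValNat q (q * m) = padicValNat q m + 1 := by
  have h1 : q ≠ 1 := by omega
  have h2 : q * m ≠ 0 := mul_ne_zero (by omega) hm
  apply le_antisymm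
  · have h : q ^ padicValNat q (q*m) ∣ q * m := (padicValNat_dvd_iff_le_of_ne_one h1 h2).2 le_rfl
    rcases Nat.eq_zero_or_pos (padicValNat q (q*m)) with h0 | h0
    · omega
    · obtain ⟨t, ht⟩ : ∃ t, padicValNat q (q*m) = t + 1 := ⟨_, (Nat.succ_pred_eq_of_pos h0).symm⟩
      rw [ht, pow_succ'] at h
      have := (padicValNat_dvd_iff_le_of_ne_one h1 hm).1 (Nat.dvd_of_mul_dvd_mul_left (by omega) h)
      omega
  · rw [← padicValNat_dvd_iff_le_of_ne_one h1 h2, pow_succ']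
    exact mul_dvd_mul_left _ ((padicValNat_dvd_iff_le_of_ne_one h1 hm).2 le_rfl)

lemma nu_le (q n : ℕ) : padicValNat q n ≤ n :=
  (padicValNat_le_nat_log n).trans (Nat.log_le_self _ _)

/-- the complex generating function -/
noncomputable def VC (q : ℕ) (z : ℂ) : ℂ := ∑' n : ℕ, (padicValNat q n : ℂ) * z ^ n

lemma geo1 {r : ℝ} (h0 : 0 ≤ r) (h1 : r < 1) : Summable (fun n : ℕ => (n : ℝ) * r ^ n) := by
  have := summable_pow_mul_geometric_of_norm_lt_one (R := ℝ) 1 (r := r)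
    (by rwa [Real.norm_of_nonneg h0])
  simpa using this

lemma term_le (q n : ℕ) (z : ℂ) : ‖(padicValNat q n : ℂ) * z ^ n‖ ≤ (n : ℝ) * ‖z‖ ^ n := by
  rw [norm_mul, norm_pow, Complex.norm_natCast]
  have : (padicValNat q n : ℝ) ≤ n := by exact_mod_cast nu_le q n
  gcongr

lemma VC_summable (q : ℕ) {z : ℂ} (hz : ‖z‖ < 1) :
    Summable (fun n : ℕ => (padicValNat q n : ℂ) * z ^ n) :=
  Summable.of_norm_bounded (geo1 (norm_nonneg z) hz) (fun n => term_le q n z)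

lemma VC_feq (q : ℕ) (hq : 2 ≤ q) {z : ℂ} (hz : ‖z‖ < 1) :
    VC q z = VC q (z ^ q) + z ^ q / (1 - z ^ q) := by
  have hw : ‖z ^ q‖ < 1 := by
    rw [norm_pow]; exact pow_lt_one₀ (norm_nonneg _) hz (by omega)
  have hinj : Function.Injective (fun m : ℕ => q * m) :=
    fun x y h => Nat.eq_of_mul_eq_mul_left (by omega) h
  have h1 : VC q z = ∑' m : ℕ, (padicValNat q (q * m) : ℂ) * z ^ (q * m) := by
    unfold VC
    refine (hinj.tsum_eq (f := fun n : ℕ => (padicValNat q n : ℂ) * z ^ n) ?_).symm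
    intro n hn
    by_contra hc
    apply hn
    have : ¬ q ∣ n := fun ⟨m, hm⟩ => hc ⟨m, hm.symm⟩
    simp [padicValNat.eq_zero_of_not_dvd this]
  have hg : HasSum (fun m : ℕ => (z ^ q) ^ m) (1 - z ^ q)⁻¹ := hasSum_geometric_of_norm_lt_one hw
  have hg' : HasSum (fun m : ℕ => (z ^ q) ^ m - (if m = 0 then 1 else 0)) ((1 - z ^ q)⁻¹ - 1) :=
    hg.sub (hasSum_ite_eq 0 1)
  have hs := (VC_summable q hw).hasSum.add hg'
  rw [h1]
  have hne : (1 - z ^ q) ≠ 0 := by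
    intro h
    rw [sub_eq_zero] at h
    rw [← h] at hw; simp at hw
  have : z ^ q / (1 - z ^ q) = (1 - z ^ q)⁻¹ - 1 := by field_simp; ring
  rw [this]
  unfold VC
  rw [← hs.tsum_eq]
  refine tsum_congr fun m => ?_
  rcases Nat.eq_zero_or_pos m with rfl | hm
  · simp
  · rw [nu_mul q m hq hm.ne', if_neg hm.ne', pow_mul]; push_cast; ring

lemma VC_feq_iter (q : ℕ) (hq : 2 ≤ q) {z : ℂ} (hz : ‖z‖ < 1) (k : ℕ) :
    VC q z = VC q (z ^ q ^ k) +
      ∑ i ∈ Finset.range k, z ^ q ^ (i + 1) / (1 - z ^ q ^ (i + 1)) := by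
  induction k with
  | zero => simp
  | succ k ih =>
    have : ‖z ^ q ^ k‖ < 1 := by
      rw [norm_pow]; exact pow_lt_one₀ (norm_nonneg _) hz (by positivity)
    rw [Finset.sum_range_succ, ih, VC_feq q hq this, ← pow_mul, ← pow_succ]
    ring

lemma VC_analytic (q : ℕ) : AnalyticOnNhd ℂ (VC q) (Metric.ball 0 1) := by
  apply DifferentiableOn.analyticOnNhd _ Metric.isOpen_ball
  intro z hz
  have hz' : ‖z‖ < 1 := by simpa using hz
  obtain ⟨r, hr1, hr2⟩ := exists_between hz'
  have hr0 : 0 ≤ r := (norm_nonneg z).trans hr1.le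
  have : DifferentiableOn ℂ (VC q) (Metric.ball 0 r) := by
    unfold VC
    refine Complex.differentiableOn_tsum_of_summable_norm (geo1 hr0 hr2) ?_ Metric.isOpen_ball ?_
    · intro n; fun_prop
    · intro n w hw
      have hw' : ‖w‖ < r := by simpa using hw
      refine (term_le q n w).trans ?_
      gcongr
  exact ((this z (by simpa using hr1)).differentiableAt
    (Metric.isOpen_ball.mem_nhds (by simpa using hr1))).differentiableWithinAt

lemma VC_re_nonneg (q : ℕ) {r : ℝ} (h0 : 0 ≤ r) : 0 ≤ (VC q (r : ℂ)).re := by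
  have : VC q (r : ℂ) = ((∑' n : ℕ, (padicValNat q n : ℝ) * r ^ n : ℝ) : ℂ) := by
    unfold VC; push_cast; rfl
  rw [this, Complex.ofReal_re]
  exact tsum_nonneg fun n => by positivity

lemma VC_pole (q : ℕ) (hq : 2 ≤ q) (m : ℕ) {ζ : ℂ} (hζ : IsPrimitiveRoot ζ (q ^ (m + 1))) :
    Tendsto (fun r : ℝ => ‖VC q (r * ζ)‖) (𝓝[<] 1) atTop := by
  have hζ1 : ‖ζ‖ = 1 := hζ.norm'_eq_one (by positivity)
  set S : ℝ → ℂ := fun r => ∑ i ∈ Finset.range m,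
    ((r:ℂ) * ζ) ^ q ^ (i + 1) / (1 - ((r:ℂ) * ζ) ^ q ^ (i + 1)) with hS
  have hSc : ContinuousAt S 1 := by
    rw [hS]
    apply tendsto_finsetSum
    intro i hi
    have hi' : i < m := Finset.mem_range.1 hi
    refine ContinuousAt.div (by fun_prop) (by fun_prop) ?_
    have : ζ ^ q ^ (i + 1) ≠ 1 :=
      hζ.pow_ne_one_of_pos_of_lt (by positivity) (Nat.pow_lt_pow_right (by omega) (by omega))
    simpa [sub_eq_zero] using this.symm
  have hSn : Tendsto (fun r => -‖S r‖) (𝓝[<] 1) (𝓝 (-‖S 1‖)) :=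
    (hSc.norm.neg).tendsto.mono_left nhdsWithin_le_nhds
  have hQ : q ^ (m + 1) ≠ 0 := by positivity
  have hden : Tendsto (fun r : ℝ => 1 - r ^ q ^ (m + 1)) (𝓝[<] 1) (𝓝[>] 0) := by
    apply tendsto_nhdsWithin_of_tendsto_nhds_of_eventually_within
    · have : ContinuousAt (fun r : ℝ => 1 - r ^ q ^ (m + 1)) 1 := by fun_prop
      have := this.tendsto.mono_left (nhdsWithin_le_nhds (s := Set.Iio 1))
      simpa using this
    · filter_upwards [Ioo_mem_nhdsLT (show (0:ℝ) < 1 by norm_num)] with r hr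
      have := pow_lt_one₀ hr.1.le hr.2 hQ
      simpa using this
  have hmain : Tendsto (fun r : ℝ => r ^ q ^ (m + 1) / (1 - r ^ q ^ (m + 1))) (𝓝[<] 1) atTop := by
    have h1 : Tendsto (fun r : ℝ => r ^ q ^ (m + 1)) (𝓝[<] 1) (𝓝 1) := by
      have : ContinuousAt (fun r : ℝ => r ^ q ^ (m + 1)) 1 := by fun_prop
      have := this.tendsto.mono_left (nhdsWithin_le_nhds (s := Set.Iio 1))
      simpa using this
    exact h1.pos_mul_atTop one_pos (tendsto_inv_nhdsGT_zero.comp hden)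
  refine tendsto_atTop_mono' _ ?_ (hmain.atTop_add hSn)
  filter_upwards [Ioo_mem_nhdsLT (show (0:ℝ) < 1 by norm_num)] with r hr
  have hrz : ‖(r:ℂ) * ζ‖ < 1 := by
    rw [norm_mul, hζ1, Complex.norm_real, Real.norm_of_nonneg hr.1.le]; simpa using hr.2
  have hp : ((r:ℂ) * ζ) ^ q ^ (m + 1) = ((r ^ q ^ (m + 1) : ℝ) : ℂ) := by
    rw [mul_pow, hζ.pow_eq_one]; push_cast; ring
  have h := VC_feq_iter q hq hrz (m + 1)
  rw [Finset.sum_range_succ, hp] at h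
  have h2 : VC q (r * ζ) - S r = VC q ((r ^ q ^ (m + 1) : ℝ) : ℂ) +
      ((r ^ q ^ (m + 1) / (1 - r ^ q ^ (m + 1)) : ℝ) : ℂ) := by
    rw [h]; simp only [hS]; push_cast; ring
  have h3 := congrArg Complex.re h2
  rw [Complex.add_re, Complex.ofReal_re] at h3
  have h4 := VC_re_nonneg q (r := r ^ q ^ (m + 1)) (pow_nonneg hr.1.le _)
  have h5 := Complex.re_le_norm (VC q (r * ζ) - S r)
  have h6 := norm_sub_le (VC q (r * ζ)) (S r)
  linarith

lemma func_transc (q : ℕ) (hq : 2 ≤ q) (p : ℕ) (A : ℕ → Polynomial ℤ) (hA : ∃ j ≤ p, A j ≠ 0)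
    (h : ∀ z ∈ Metric.ball (0:ℂ) 1,
      ∑ j ∈ Finset.range (p + 1), Polynomial.aeval z (A j) * VC q z ^ j = 0) : False := by
  classical
  set J := Nat.findGreatest (fun j => A j ≠ 0) p with hJ
  have hJ0 : A J ≠ 0 := by
    obtain ⟨j, hj, hj0⟩ := hA
    exact Nat.findGreatest_spec (P := fun j => A j ≠ 0) hj hj0
  have hJp : J ≤ p := Nat.findGreatest_le p
  have hgt : ∀ j, J < j → j ≤ p → A j = 0 := by
    intro j h1 h2
    have := Nat.findGreatest_is_greatest (P := fun j => A j ≠ 0) h1 h2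
    simpa using this
  have h' : ∀ z ∈ Metric.ball (0:ℂ) 1,
      ∑ j ∈ Finset.range (J + 1), Polynomial.aeval z (A j) * VC q z ^ j = 0 := by
    intro z hz
    rw [← h z hz]
    apply Finset.sum_subset
    · intro x; simp; omega
    · intro x hx hx'
      simp at hx hx'
      rw [hgt x (by omega) (by omega)]; simp
  have key : ∀ m : ℕ, ∀ ζ : ℂ, IsPrimitiveRoot ζ (q ^ (m + 1)) →
      Polynomial.aeval ζ (A J) = 0 := by
    intro m ζ hζ
    have hζ1 : ‖ζ‖ = 1 := hζ.norm'_eq_one (by positivity)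
    have hp := VC_pole q hq m hζ
    have hinv : Tendsto (fun r : ℝ => (VC q (r * ζ))⁻¹) (𝓝[<] 1) (𝓝 0) :=
      tendsto_inv₀_cobounded.comp (tendsto_norm_atTop_iff_cobounded.1 hp)
    have hlim : Tendsto (fun r : ℝ => ∑ j ∈ Finset.range (J + 1),
        Polynomial.aeval ((r:ℂ) * ζ) (A j) * ((VC q (r * ζ))⁻¹) ^ (J - j)) (𝓝[<] 1)
        (𝓝 (∑ j ∈ Finset.range (J + 1), Polynomial.aeval ζ (A j) * 0 ^ (J - j))) := by
      apply tendsto_finsetSum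
      intro j hj
      refine Tendsto.mul ?_ (hinv.pow _)
      have hc : Continuous (fun r : ℝ => Polynomial.aeval ((r:ℂ) * ζ) (A j)) :=
        (Polynomial.continuous_aeval (A j)).comp (by fun_prop)
      have := (hc.tendsto 1).mono_left (nhdsWithin_le_nhds (s := Set.Iio 1))
      simpa using this
    have hval : (∑ j ∈ Finset.range (J + 1), Polynomial.aeval ζ (A j) * (0:ℂ) ^ (J - j))
        = Polynomial.aeval ζ (A J) := by
      rw [Finset.sum_range_succ, Finset.sum_eq_zero]
      · simp
      · intro j hj
        have : J - j ≠ 0 := by have := Finset.mem_range.1 hj; omega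
        simp [this]
    rw [hval] at hlim
    refine tendsto_nhds_unique hlim (tendsto_const_nhds.congr' ?_)
    filter_upwards [Ioo_mem_nhdsLT (show (0:ℝ) < 1 by norm_num), hp.eventually_gt_atTop 0]
      with r hr hr2
    have hV : VC q (r * ζ) ≠ 0 := norm_pos_iff.1 hr2
    have hrz : ‖(r:ℂ) * ζ‖ < 1 := by
      rw [norm_mul, hζ1, Complex.norm_real, Real.norm_of_nonneg hr.1.le]; simpa using hr.2
    have h0 := h' (r * ζ) (by simpa using hrz)
    apply mul_left_cancel₀ (pow_ne_zero J hV)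
    rw [mul_zero, ← h0, Finset.mul_sum]
    apply Finset.sum_congr rfl
    intro j hj
    have hj' : j ≤ J := by have := Finset.mem_range.1 hj; omega
    obtain ⟨t, ht⟩ := Nat.exists_eq_add_of_le hj'
    rw [ht, Nat.add_sub_cancel_left, pow_add, inv_pow]
    field_simp
  have hP : (A J).map (Int.castRingHom ℂ) ≠ 0 := by
    rwa [Ne, Polynomial.map_eq_zero_iff (RingHom.injective_int _)]
  apply hP
  apply Polynomial.eq_zero_of_infinite_isRoot
  have hprim : ∀ m : ℕ, IsPrimitiveRoot (Complex.exp (2 * Real.pi * Complex.I / (q ^ (m+1) : ℕ)))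
      (q ^ (m + 1)) := fun m => Complex.isPrimitiveRoot_exp _ (by positivity)
  refine Set.infinite_of_injective_forall_mem
    (f := fun m : ℕ => Complex.exp (2 * Real.pi * Complex.I / (q ^ (m+1) : ℕ))) ?_ ?_
  · intro m n hmn
    have h1 := hprim m
    simp only at hmn
    rw [hmn] at h1
    have := Nat.pow_right_injective hq (h1.unique (hprim n))
    omega
  · intro m
    have := key m _ (hprim m)
    simp only [Set.mem_ofPred_eq, Polynomial.IsRoot.def, Polynomial.eval_map]
    exact this

lemma aux_exists (p N : ℕ) (hN : N < (p + 1) * (p + 1)) (T : Polynomial ℤ) :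
    ∃ A : ℕ → Polynomial ℤ, (∀ j, (A j).natDegree ≤ p) ∧ (∃ j ≤ p, A j ≠ 0) ∧
      Polynomial.X ^ N ∣ ∑ j ∈ Finset.range (p + 1), A j * T ^ j := by
  classical
  let M : Matrix (Fin N) (Fin (p+1) × Fin (p+1)) ℤ :=
    fun n x => (Polynomial.X ^ (x.2 : ℕ) * T ^ (x.1 : ℕ)).coeff n
  have hni : ¬ Function.Injective M.mulVecLin := by
    intro hi
    have := card_le_of_injective ℤ M.mulVecLin hi
    simp at this
    omega
  rw [← LinearMap.ker_eq_bot, Submodule.eq_bot_iff] at hni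
  push Not at hni
  obtain ⟨v, hv, hv0⟩ := hni
  have hv' : M.mulVec v = 0 := by simpa using hv
  let A : ℕ → Polynomial ℤ := fun j => if hj : j < p + 1 then
    ∑ i : Fin (p+1), Polynomial.C (v (⟨j, hj⟩, i)) * Polynomial.X ^ (i : ℕ) else 0
  have hAj : ∀ j : Fin (p+1), A j = ∑ i : Fin (p+1), Polynomial.C (v (j, i)) * Polynomial.X ^ (i : ℕ) := by
    intro j; simp only [A]; rw [dif_pos j.2]
  refine ⟨A, ?_, ?_, ?_⟩
  · intro j
    simp only [A]
    split_ifs with hj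
    · apply Polynomial.natDegree_sum_le_of_forall_le
      intro i _
      exact (Polynomial.natDegree_C_mul_X_pow_le _ _).trans (by omega)
    · simp
  · obtain ⟨⟨j, i⟩, hji⟩ := Function.ne_iff.1 hv0
    refine ⟨j, by omega, ?_⟩
    intro h0
    apply hji
    rw [hAj] at h0
    have := congrArg (fun P => Polynomial.coeff P (i:ℕ)) h0
    simp only [Polynomial.finsetSum_coeff, Polynomial.coeff_C_mul_X_pow, Polynomial.coeff_zero] at this
    simpa [Fin.val_inj] using this
  · rw [Polynomial.X_pow_dvd_iff]
    intro n hn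
    have h1 := congrFun hv' ⟨n, hn⟩
    rw [Finset.sum_range, Polynomial.finsetSum_coeff]
    simp only [hAj]
    simp only [Matrix.mulVec, dotProduct, M, Fintype.sum_prod_type, Pi.zero_apply] at h1
    rw [← h1]
    apply Finset.sum_congr rfl
    intro j _
    rw [Finset.sum_mul, Polynomial.finsetSum_coeff]
    apply Finset.sum_congr rfl
    intro i _
    rw [mul_assoc, Polynomial.coeff_C_mul, mul_comm]

lemma liouville_nf (K : Type) [Field K] [NumberField K] (g : K) (ι : K →ₐ[ℚ] ℂ) :
    ∃ d : ℕ, ∃ R : ℝ, 0 ≤ R ∧ ∃ c : ℝ, 1 ≤ c ∧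
    ∀ (p : ℕ) (Q : Polynomial ℤ) (B : ℝ), Q.natDegree ≤ p →
      (∀ x : ℂ, ‖x‖ ≤ R → ‖Polynomial.aeval x Q‖ ≤ B) → Polynomial.aeval (ι g) Q ≠ 0 →
      1 ≤ (c ^ p) ^ (d + 1) * B ^ d * ‖Polynomial.aeval (ι g) Q‖ := by
  classical
  have hgalg : IsAlgebraic ℤ g := by
    rw [IsFractionRing.isAlgebraic_iff ℤ ℚ K]
    exact Algebra.IsAlgebraic.isAlgebraic g
  obtain ⟨c, hc0, hcint⟩ := hgalg.exists_integral_multiple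
  let R : ℝ := ∑ σ : K →ₐ[ℚ] ℂ, ‖σ g‖
  have hR : ∀ σ : K →ₐ[ℚ] ℂ, ‖σ g‖ ≤ R := fun σ =>
    Finset.single_le_sum (f := fun σ : K →ₐ[ℚ] ℂ => ‖σ g‖) (fun _ _ => norm_nonneg _)
      (Finset.mem_univ σ)
  have hc1 : (1:ℝ) ≤ |(c:ℝ)| := by exact_mod_cast Int.one_le_abs hc0
  refine ⟨(Finset.univ.erase ι).card, R, Finset.sum_nonneg fun _ _ => norm_nonneg _,
    |(c:ℝ)|, hc1, ?_⟩
  intro p Q B hQ hB hne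
  let β : K := (c:K) ^ p * Polynomial.aeval g Q
  have hβint : IsIntegral ℤ β := by
    have : β = ∑ i ∈ Finset.range (p+1), (((Q.coeff i * c ^ (p - i) : ℤ)) : K) * (c • g) ^ i := by
      simp only [β]
      rw [Polynomial.aeval_eq_sum_range' (n := p+1) (by omega), Finset.mul_sum]
      apply Finset.sum_congr rfl
      intro i hi
      have : i ≤ p := by have := Finset.mem_range.1 hi; omega
      obtain ⟨t, rfl⟩ := Nat.exists_eq_add_of_le this
      rw [Nat.add_sub_cancel_left]
      simp only [zsmul_eq_mul]
      push_cast
      ring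
    rw [this]
    apply IsIntegral.sum
    intro i _
    exact (isIntegral_algebraMap (R := ℤ) (x := Q.coeff i * c ^ (p - i))).mul (hcint.pow i)
  have hσ : ∀ σ : K →ₐ[ℚ] ℂ, σ β = (c:ℂ) ^ p * Polynomial.aeval (σ g) Q := by
    intro σ
    simp only [β, map_mul, map_pow, map_intCast]
    congr 1
    exact (Polynomial.aeval_algHom_apply (σ.restrictScalars ℤ) g Q).symm
  have hβ0 : β ≠ 0 := by
    intro h0
    have := hσ ι
    rw [h0, map_zero] at this
    have hc : (c:ℂ) ^ p ≠ 0 := pow_ne_zero _ (by exact_mod_cast hc0)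
    exact (mul_ne_zero hc hne) this.symm
  obtain ⟨n, hn⟩ := IsIntegrallyClosed.isIntegral_iff.1 (Algebra.isIntegral_norm ℚ hβint)
  have hn0 : n ≠ 0 := by
    rintro rfl
    rw [map_zero] at hn
    exact hβ0 (Algebra.norm_eq_zero_iff.1 hn.symm)
  have hprod := Algebra.norm_eq_prod_embeddings ℚ ℂ β
  rw [← hn] at hprod
  have hnorm : ‖(n:ℂ)‖ = ∏ σ : K →ₐ[ℚ] ℂ, ‖σ β‖ := by
    rw [← norm_prod, ← hprod]; simp
  have h1 : (1:ℝ) ≤ ‖(n:ℂ)‖ := by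
    rw [Complex.norm_intCast]; exact_mod_cast Int.one_le_abs hn0
  rw [hnorm, ← Finset.mul_prod_erase _ _ (Finset.mem_univ ι)] at h1
  have hle : ∏ σ ∈ Finset.univ.erase ι, ‖σ β‖ ≤ (|(c:ℝ)| ^ p * B) ^ (Finset.univ.erase ι).card := by
    rw [← Finset.prod_const]
    apply Finset.prod_le_prod
    · intro σ _; exact norm_nonneg _
    · intro σ _
      rw [hσ σ, norm_mul, norm_pow, Complex.norm_intCast]
      exact mul_le_mul_of_nonneg_left (hB _ (hR σ)) (by positivity)
  have h2 : ‖ι β‖ = |(c:ℝ)| ^ p * ‖Polynomial.aeval (ι g) Q‖ := by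
    rw [hσ, norm_mul, norm_pow, Complex.norm_intCast]
  calc (1:ℝ) ≤ _ := h1
    _ ≤ ‖ι β‖ * (|(c:ℝ)| ^ p * B) ^ (Finset.univ.erase ι).card := by gcongr
    _ = _ := by rw [h2, mul_pow]; ring

lemma liouville_bd (θ : ℂ) (hθ : IsAlgebraic ℚ θ) : ∃ d : ℕ, ∃ R : ℝ, 0 ≤ R ∧ ∃ c : ℝ, 1 ≤ c ∧
    ∀ (p : ℕ) (Q : Polynomial ℤ) (B : ℝ), Q.natDegree ≤ p →
      (∀ x : ℂ, ‖x‖ ≤ R → ‖Polynomial.aeval x Q‖ ≤ B) → Polynomial.aeval θ Q ≠ 0 →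
      1 ≤ (c ^ p) ^ (d + 1) * B ^ d * ‖Polynomial.aeval θ Q‖ := by
  have hint : IsIntegral ℚ θ := hθ.isIntegral
  have hfd : FiniteDimensional ℚ (IntermediateField.adjoin ℚ {θ}) :=
    IntermediateField.adjoin.finiteDimensional hint
  have hnf : NumberField (IntermediateField.adjoin ℚ {θ}) :=
    { to_charZero := inferInstance, to_finiteDimensional := by convert hfd }
  have h := liouville_nf (IntermediateField.adjoin ℚ {θ}) (IntermediateField.AdjoinSimple.gen ℚ θ)
    (algebraMap (IntermediateField.adjoin ℚ {θ}) ℂ).toRatAlgHom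
  have e : (algebraMap (IntermediateField.adjoin ℚ {θ}) ℂ).toRatAlgHom
    (IntermediateField.AdjoinSimple.gen ℚ θ) = θ := rfl
  rw [e] at h
  exact h

open Asymptotics in
lemma trunc_bigO (q N : ℕ) : ∃ T : Polynomial ℤ,
    (fun z : ℂ => VC q z - Polynomial.aeval z T) =O[𝓝 0] fun z => z ^ N := by
  refine ⟨∑ n ∈ Finset.range N, Polynomial.C (padicValNat q n : ℤ) * Polynomial.X ^ n, ?_⟩
  have hs : Summable (fun n : ℕ => ((n + N : ℕ) : ℝ) * (1/2 : ℝ) ^ n) := by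
    have h1 := geo1 (r := 1/2) (by norm_num) (by norm_num)
    have h2 := (summable_geometric_of_lt_one (r := (1/2:ℝ)) (by norm_num) (by norm_num)).mul_left (N:ℝ)
    refine (h1.add h2).congr fun n => ?_
    push_cast; ring
  refine IsBigO.of_bound (∑' n : ℕ, ((n + N : ℕ) : ℝ) * (1/2 : ℝ) ^ n) ?_
  filter_upwards [Metric.ball_mem_nhds (0:ℂ) (show (0:ℝ) < 1/2 by norm_num)] with z hz
  have hz' : ‖z‖ < 1/2 := by simpa using hz
  have hsum := VC_summable q (z := z) (by linarith)
  have h1 : VC q z - Polynomial.aeval z (∑ n ∈ Finset.range N,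
      Polynomial.C (padicValNat q n : ℤ) * Polynomial.X ^ n)
      = ∑' n : ℕ, z ^ N * ((padicValNat q (n + N) : ℂ) * z ^ n) := by
    have := hsum.sum_add_tsum_nat_add N
    unfold VC
    rw [← this]
    simp only [map_sum, map_mul, map_pow, Polynomial.aeval_X, Polynomial.aeval_C]
    simp only [algebraMap_int_eq, eq_intCast, Int.cast_natCast, add_sub_cancel_left]
    refine tsum_congr fun n => ?_
    rw [pow_add]; ring
  rw [h1, tsum_mul_left, norm_mul, norm_pow, mul_comm]
  gcongr
  refine tsum_of_norm_bounded hs.hasSum fun n => ?_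
  rw [norm_mul, norm_pow, Complex.norm_natCast]
  have : (padicValNat q (n + N) : ℝ) ≤ (n + N : ℕ) := by exact_mod_cast nu_le q _
  gcongr

open Asymptotics in
lemma E_bigO (q p N : ℕ) (A : ℕ → Polynomial ℤ) (T : Polynomial ℤ)
    (hT : (fun z : ℂ => VC q z - Polynomial.aeval z T) =O[𝓝 0] fun z => z ^ N)
    (hd : Polynomial.X ^ N ∣ ∑ j ∈ Finset.range (p + 1), A j * T ^ j) :
    (fun z : ℂ => ∑ j ∈ Finset.range (p + 1), Polynomial.aeval z (A j) * VC q z ^ j)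
      =O[𝓝 0] fun z => z ^ N := by
  have hV : ContinuousAt (VC q) 0 := ((VC_analytic q) 0 (by simp)).continuousAt
  have hP : ∀ P : Polynomial ℤ, ContinuousAt (fun z : ℂ => Polynomial.aeval z P) 0 :=
    fun P => (Polynomial.continuous_aeval P).continuousAt
  obtain ⟨G, hG⟩ := hd
  have e : (fun z : ℂ => ∑ j ∈ Finset.range (p + 1), Polynomial.aeval z (A j) * VC q z ^ j)
    = fun z : ℂ => z ^ N * Polynomial.aeval z G + (VC q z - Polynomial.aeval z T) *
      ∑ j ∈ Finset.range (p + 1), Polynomial.aeval z (A j) *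
        ∑ i ∈ Finset.range j, VC q z ^ i * (Polynomial.aeval z T) ^ (j - 1 - i) := by
    funext z
    have h1 := congrArg (Polynomial.aeval z) hG
    simp only [map_sum, map_mul, map_pow, Polynomial.aeval_X] at h1
    rw [← h1, Finset.mul_sum, ← Finset.sum_add_distrib]
    apply Finset.sum_congr rfl
    intro j _
    have h2 := (Commute.all (VC q z) (Polynomial.aeval z T)).geom_sum₂_mul j
    linear_combination (-(Polynomial.aeval z (A j))) * h2
  rw [e]
  apply IsBigO.add
  · have : (fun z : ℂ => z ^ N * Polynomial.aeval z G) =O[𝓝 0] fun z => z ^ N * (1:ℂ) :=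
      (isBigO_refl _ _).mul ((hP G).tendsto.isBigO_one ℂ)
    simpa using this
  · have hc : ContinuousAt (fun z : ℂ => ∑ j ∈ Finset.range (p + 1), Polynomial.aeval z (A j) *
        ∑ i ∈ Finset.range j, VC q z ^ i * (Polynomial.aeval z T) ^ (j - 1 - i)) 0 := by
      apply tendsto_finsetSum
      intro j _
      refine (hP _).mul ?_
      apply tendsto_finsetSum
      intro i _
      exact (hV.pow _).mul ((hP _).pow _)
    have := hT.mul (hc.tendsto.isBigO_one ℂ)
    simpa using this

lemma clear_den (p : ℕ) (A : ℕ → Polynomial ℤ) (hA : ∀ j, (A j).natDegree ≤ p) (u w D n : ℤ)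
    (hw : w ≠ 0) (hD : D ≠ 0) : ∃ Q : Polynomial ℤ, Q.natDegree ≤ p ∧ ∀ x : ℂ,
      Polynomial.aeval x Q = ((w:ℂ) * D) ^ p *
        ∑ j ∈ Finset.range (p + 1), Polynomial.aeval ((u:ℂ) / w) (A j) * (x - n / D) ^ j := by
  have hw' : (w:ℂ) ≠ 0 := by exact_mod_cast hw
  have hD' : (D:ℂ) ≠ 0 := by exact_mod_cast hD
  let s : ℕ → ℤ := fun j => ∑ i ∈ Finset.range (p + 1), (A j).coeff i * u ^ i * w ^ (p - i)
  have hs : ∀ j, ((s j : ℤ) : ℂ) = (w:ℂ) ^ p * Polynomial.aeval ((u:ℂ) / w) (A j) := by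
    intro j
    rw [Polynomial.aeval_eq_sum_range' (n := p + 1) (by have := hA j; omega), Finset.mul_sum]
    simp only [s]
    push_cast
    apply Finset.sum_congr rfl
    intro i hi
    have : i ≤ p := by have := Finset.mem_range.1 hi; omega
    obtain ⟨t, rfl⟩ := Nat.exists_eq_add_of_le this
    rw [Nat.add_sub_cancel_left, zsmul_eq_mul, div_pow, pow_add]
    field_simp
  refine ⟨∑ j ∈ Finset.range (p + 1), Polynomial.C (s j * D ^ (p - j)) *
    (Polynomial.C D * Polynomial.X - Polynomial.C n) ^ j, ?_, ?_⟩
  · apply Polynomial.natDegree_sum_le_of_forall_le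
    intro j hj
    have hj' : j ≤ p := by have := Finset.mem_range.1 hj; omega
    refine (Polynomial.natDegree_C_mul_le _ _).trans (Polynomial.natDegree_pow_le.trans ?_)
    have : (Polynomial.C D * Polynomial.X - Polynomial.C n).natDegree ≤ 1 := by compute_degree
    calc j * _ ≤ j * 1 := Nat.mul_le_mul_left _ this
      _ ≤ p := by omega
  · intro x
    rw [Finset.mul_sum, map_sum]
    apply Finset.sum_congr rfl
    intro j hj
    have hj' : j ≤ p := by have := Finset.mem_range.1 hj; omega
    simp only [map_mul, map_pow, map_sub, Polynomial.aeval_X, eq_intCast, map_intCast, hs]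
    have h1 : (D:ℂ) * x - n = D * (x - n / D) := by field_simp
    rw [h1, mul_pow, mul_pow]
    have h2 : (D:ℂ) ^ p = D ^ (p - j) * D ^ j := by rw [← pow_add]; congr 1; omega
    rw [h2]
    ring

lemma rk_den (q a b : ℕ) (hq : 2 ≤ q) (hab : a < b) (k : ℕ) : ∃ n : ℤ,
    ∑ i ∈ Finset.range k, ((a:ℂ) / b) ^ q ^ (i + 1) / (1 - ((a:ℂ) / b) ^ q ^ (i + 1))
      = (n : ℂ) / (((b:ℤ) ^ q ^ k - (a:ℤ) ^ q ^ k : ℤ) : ℂ) := by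
  have hD : ∀ m : ℕ, m ≠ 0 → (((b:ℤ) ^ m - (a:ℤ) ^ m : ℤ) : ℂ) ≠ 0 := by
    intro m hm
    have : (a:ℤ) ^ m < (b:ℤ) ^ m := pow_lt_pow_left₀ (by exact_mod_cast hab) (by positivity) hm
    exact_mod_cast (sub_pos.2 this).ne'
  have hb : (b:ℂ) ≠ 0 := by
    have : b ≠ 0 := by omega
    exact_mod_cast this
  have hdvd : ∀ i ∈ Finset.range k, ∃ n : ℤ, ((a:ℂ) / b) ^ q ^ (i + 1) /
      (1 - ((a:ℂ) / b) ^ q ^ (i + 1)) = (n : ℂ) / (((b:ℤ) ^ q ^ k - (a:ℤ) ^ q ^ k : ℤ) : ℂ) := by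
    intro i hi
    have hi' : i + 1 ≤ k := Finset.mem_range.1 hi
    obtain ⟨t, ht⟩ := Nat.exists_eq_add_of_le hi'
    obtain ⟨e, he⟩ := sub_dvd_pow_sub_pow ((b:ℤ) ^ q ^ (i + 1)) ((a:ℤ) ^ q ^ (i + 1)) (q ^ t)
    rw [← pow_mul, ← pow_mul, ← pow_add, ← ht] at he
    refine ⟨a ^ q ^ (i + 1) * e, ?_⟩
    have h1 := hD (q ^ (i + 1)) (by positivity)
    have h2 := hD (q ^ k) (by positivity)
    rw [he] at h2 ⊢
    push_cast at h1 h2 ⊢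
    have h3 : (e:ℂ) ≠ 0 := right_ne_zero_of_mul h2
    rw [mul_div_mul_right _ _ h3, div_pow]
    field_simp
  choose! f hf using hdvd
  refine ⟨∑ i ∈ Finset.range k, f i, ?_⟩
  rw [Finset.sum_congr rfl hf, ← Finset.sum_div]
  push_cast
  rfl

lemma VC_transc (q a b : ℕ) (hq : 2 ≤ q) (ha : 0 < a) (hab : a < b)
    (hθ : IsAlgebraic ℚ (VC q ((a:ℂ) / b))) : False := by
  set α : ℂ := (a:ℂ) / b with hα
  set θ : ℂ := VC q α with hθdef
  have hb0 : (0:ℝ) < b := by exact_mod_cast (by omega : 0 < b)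
  have ha0 : (0:ℝ) < a := by exact_mod_cast ha
  have hb1 : (1:ℝ) ≤ b := by exact_mod_cast (by omega : 1 ≤ b)
  have hαn : ‖α‖ = (a:ℝ) / b := by simp [hα]
  have hα1 : ‖α‖ < 1 := by
    rw [hαn, div_lt_one hb0]; exact_mod_cast hab
  have hα0 : α ≠ 0 := by
    rw [← norm_pos_iff, hαn]; positivity
  obtain ⟨d, R, hR, c, hc, hL⟩ := liouville_bd θ hθ
  -- choice of `p`
  obtain ⟨p, hp0, hp⟩ : ∃ p : ℕ, p ≠ 0 ∧ (b:ℝ) ^ (2 * (d + 1)) * ‖α‖ ^ p < 1 := by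
    have h := (tendsto_pow_atTop_nhds_zero_of_lt_one (norm_nonneg α) hα1).const_mul
      ((b:ℝ) ^ (2 * (d + 1)))
    rw [mul_zero] at h
    obtain ⟨p, h1, h2⟩ := ((eventually_ne_atTop 0).and
      (h.eventually (gt_mem_nhds one_pos))).exists
    exact ⟨p, h1, h2⟩
  obtain ⟨T, hT⟩ := trunc_bigO q (p * p)
  obtain ⟨A, hAdeg, hAne, hAd⟩ := aux_exists p (p * p) (by nlinarith) T
  have hE := E_bigO q p (p * p) A T hT hAd
  set E : ℂ → ℂ := fun z => ∑ j ∈ Finset.range (p + 1), Polynomial.aeval z (A j) * VC q z ^ j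
    with hEdef
  obtain ⟨C2, hC2pos, hC2⟩ := hE.exists_pos
  have hC2' := hC2.bound
  -- the sequence of points
  have hqk : Tendsto (fun k : ℕ => q ^ k) atTop atTop :=
    tendsto_pow_atTop_atTop_of_one_lt (by omega)
  have hz0 : Tendsto (fun k : ℕ => α ^ q ^ k) atTop (𝓝 0) :=
    (tendsto_pow_atTop_nhds_zero_of_norm_lt_one hα1).comp hqk
  have hz0' : Tendsto (fun k : ℕ => α ^ q ^ k) atTop (𝓝[≠] 0) :=
    tendsto_nhdsWithin_of_tendsto_nhds_of_eventually_within _ hz0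
      (Eventually.of_forall fun k => pow_ne_zero _ hα0)
  -- nonvanishing
  have hfreq : ∃ᶠ k in atTop, E (α ^ q ^ k) ≠ 0 := by
    intro hev
    have hev' : ∀ᶠ k in atTop, E (α ^ q ^ k) = 0 := by simpa using hev
    have hEan : AnalyticOnNhd ℂ E (Metric.ball 0 1) := by
      intro z hz
      rw [hEdef]
      apply Finset.analyticAt_fun_sum
      intro j _
      refine AnalyticAt.mul ?_ ((VC_analytic q z hz).pow j)
      have hd : Differentiable ℂ (fun z : ℂ => Polynomial.aeval z (A j)) :=
        (A j).differentiable_aeval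
      exact hd.analyticAt z
    have := hEan.eqOn_zero_of_preconnected_of_frequently_eq_zero
      (convex_ball (0:ℂ) 1).isPreconnected (z₀ := 0) (by simp)
      (hz0'.frequently hev'.frequently)
    exact func_transc q hq p A hAne fun z hz => this hz
  -- eventual bounds
  have hV : ContinuousAt (VC q) 0 := ((VC_analytic q) 0 (by simp)).continuousAt
  have hVb : ∀ᶠ k in atTop, ‖VC q (α ^ q ^ k)‖ < ‖VC q 0‖ + 1 :=
    ((hV.norm.tendsto).comp hz0).eventually (gt_mem_nhds (by linarith))
  set M : ℝ := ‖θ‖ + (‖VC q 0‖ + 1) with hM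
  have hM0 : 0 ≤ M := by positivity
  let F : ℂ → ℝ := fun z => ∑ j ∈ Finset.range (p + 1), ‖Polynomial.aeval z (A j)‖ * (R + M) ^ j
  have hFc : ContinuousAt F 0 := by
    apply tendsto_finsetSum
    intro j _
    exact (((A j).continuous_aeval.norm).mul continuous_const).continuousAt
  have hFb : ∀ᶠ k in atTop, F (α ^ q ^ k) < F 0 + 1 :=
    (hFc.tendsto.comp hz0).eventually (gt_mem_nhds (by linarith))
  have hF0 : 0 ≤ F 0 := Finset.sum_nonneg fun j _ => by positivity
  set C1 : ℝ := F 0 + 1 with hC1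
  set C3 : ℝ := (c ^ p) ^ (d + 1) * C1 ^ d * C2 with hC3
  set x : ℝ := ((b:ℝ) ^ (2 * (d + 1)) * ‖α‖ ^ p) ^ p with hx
  have hx0 : 0 ≤ x := by positivity
  have hx1 : x < 1 := pow_lt_one₀ (by positivity) hp hp0
  have hsmall : ∀ᶠ k : ℕ in atTop, C3 * x ^ q ^ k < 1 := by
    have h := ((tendsto_pow_atTop_nhds_zero_of_lt_one hx0 hx1).comp hqk).const_mul C3
    rw [mul_zero] at h
    exact h.eventually (gt_mem_nhds one_pos)
  obtain ⟨k, hEk, hVk, hFk, hsk, hCk⟩ :=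
    (hfreq.and_eventually (hVb.and (hFb.and (hsmall.and (hz0.eventually hC2'))))).exists
  set z := α ^ q ^ k with hz
  obtain ⟨n, hn⟩ := rk_den q a b hq hab k
  have hfe := VC_feq_iter q hq hα1 k
  rw [hn] at hfe
  set D : ℤ := (b:ℤ) ^ q ^ k - (a:ℤ) ^ q ^ k with hD
  have hD0 : 0 < D := by
    rw [hD, sub_pos]
    exact pow_lt_pow_left₀ (by exact_mod_cast hab) (by positivity) (by positivity)
  have hDle : (D:ℝ) ≤ (b:ℝ) ^ q ^ k := by
    rw [hD]; push_cast
    have : (0:ℝ) ≤ (a:ℝ) ^ q ^ k := by positivity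
    linarith
  have hVz : VC q z = θ - n / D := by
    rw [hθdef, hfe]; ring
  have hnD : ‖(n:ℂ) / D‖ ≤ M := by
    have : (n:ℂ) / D = θ - VC q z := by rw [hVz]; ring
    rw [this]
    exact (norm_sub_le _ _).trans (by rw [hM]; linarith)
  obtain ⟨Q, hQdeg, hQ⟩ := clear_den p A hAdeg ((a:ℤ) ^ q ^ k) ((b:ℤ) ^ q ^ k) D n
    (by have : (b:ℤ) ≠ 0 := by omega
        exact pow_ne_zero _ this) hD0.ne'
  have hzz : (((a:ℤ) ^ q ^ k : ℤ) : ℂ) / (((b:ℤ) ^ q ^ k : ℤ) : ℂ) = z := by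
    rw [hz, hα, div_pow]; push_cast; rfl
  rw [hzz] at hQ
  set W : ℝ := (b:ℝ) ^ q ^ k with hW
  have hW0 : 0 < W := by positivity
  have hpre : ‖((((b:ℤ) ^ q ^ k : ℤ) : ℂ) * (D:ℂ)) ^ p‖ ≤ W ^ (2 * p) := by
    rw [norm_pow, norm_mul, Complex.norm_intCast, Complex.norm_intCast, pow_mul]
    have h1 : |(D:ℝ)| ≤ W := by rw [abs_of_pos (by exact_mod_cast hD0)]; exact hDle
    have h2 : |(((b:ℤ) ^ q ^ k : ℤ) : ℝ)| = W := by
      push_cast; exact abs_of_pos hW0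
    rw [h2, sq]
    gcongr
  have hQθ : Polynomial.aeval θ Q = ((((b:ℤ) ^ q ^ k : ℤ) : ℂ) * (D:ℂ)) ^ p * E z := by
    rw [hQ θ, ← hVz]
  have hQne : Polynomial.aeval θ Q ≠ 0 := by
    rw [hQθ]
    refine mul_ne_zero (pow_ne_zero _ (mul_ne_zero ?_ ?_)) hEk
    · have : (b:ℤ) ≠ 0 := by omega
      exact_mod_cast pow_ne_zero (q ^ k) this
    · exact_mod_cast hD0.ne'
  have hQB : ∀ y : ℂ, ‖y‖ ≤ R → ‖Polynomial.aeval y Q‖ ≤ W ^ (2 * p) * C1 := by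
    intro y hy
    rw [hQ y, norm_mul]
    refine mul_le_mul hpre ?_ (norm_nonneg _) (by positivity)
    refine le_trans (norm_sum_le _ _) (le_trans (Finset.sum_le_sum fun j _ => ?_) hFk.le)
    rw [norm_mul, norm_pow]
    have : ‖y - n / D‖ ≤ R + M := (norm_sub_le _ _).trans (add_le_add hy hnD)
    gcongr
  have hfin := hL p Q _ hQdeg hQB hQne
  have hEz : ‖E z‖ ≤ C2 * (‖α‖ ^ q ^ k) ^ (p * p) := by
    have := hCk
    rwa [norm_pow, hz, norm_pow] at this
  have hQθn : ‖Polynomial.aeval θ Q‖ ≤ W ^ (2 * p) * (C2 * (‖α‖ ^ q ^ k) ^ (p * p)) := by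
    rw [hQθ, norm_mul]
    exact mul_le_mul hpre hEz (norm_nonneg _) (by positivity)
  have hlast : (c ^ p) ^ (d + 1) * (W ^ (2 * p) * C1) ^ d * ‖Polynomial.aeval θ Q‖
      ≤ C3 * x ^ q ^ k := by
    calc _ ≤ (c ^ p) ^ (d + 1) * (W ^ (2 * p) * C1) ^ d *
          (W ^ (2 * p) * (C2 * (‖α‖ ^ q ^ k) ^ (p * p))) := by gcongr
      _ = C3 * (W ^ (2 * (d + 1) * p) * (‖α‖ ^ q ^ k) ^ (p * p)) := by
          rw [hC3, mul_pow, ← pow_mul W]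
          have : W ^ (2 * (d + 1) * p) = W ^ (2 * p * d) * W ^ (2 * p) := by
            rw [← pow_add]; congr 1; ring
          rw [this]; ring
      _ = C3 * x ^ q ^ k := by
          congr 1
          rw [hx, hW, mul_pow, mul_pow, ← pow_mul, ← pow_mul, ← pow_mul, ← pow_mul, ← pow_mul,
            ← pow_mul]
          congr 2 <;> ring
  linarith


/-- Let `a`, `b` be relatively prime positive integers with `a/b < 1` and let
`q ≥ 2` be an integer with `q > 2·log b / (log b − log a)`. Then the real number
`V_q(a/b) = ∑_{n ≥ 1} ν_q(n)·(a/b)ⁿ` is transcendental over `ℚ`. -/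
theorem Vq_rational_value_transcendental (q a b : ℕ) (hq : 2 ≤ q)
    (ha : 0 < a) (hb : 0 < b) (hab : Nat.Coprime a b) (hlt : (a : ℝ) / b < 1)
    (hcond : 2 * Real.log b / (Real.log b - Real.log a) < q) :
    Transcendental ℚ (∑' n : ℕ, (padicValNat q n : ℝ) * ((a : ℝ) / b) ^ n) := by
  intro halg
  have hb0 : (0:ℝ) < b := by exact_mod_cast hb
  have hab' : a < b := by
    rw [div_lt_one hb0] at hlt
    exact_mod_cast hlt
  apply VC_transc q a b hq ha hab'
  have h := halg.algebraMap (A := ℂ)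
  have e : algebraMap ℝ ℂ (∑' n : ℕ, (padicValNat q n : ℝ) * ((a : ℝ) / b) ^ n)
      = VC q ((a:ℂ) / b) := by
    unfold VC
    simp only [Complex.coe_algebraMap]
    push_cast
    rfl
  rwa [e] at h
end

section
/- Let a and b be relatively prime positive integers with a/b < 1, let k ≥ 2 be an integer, and let q ≥ 2 be an integer satisfying q > 2·log b / (log b − log a). Then the real number V_{q,k}(a/b) = ∑_{n≥1} (ν_q(n) mod k)·(a/b)^n is transcendental over ℚ. -/
namespace MahlerV

open Polynomial

lemma pv_mul (q n : ℕ) (hq : 2 ≤ q) (hn : n ≠ 0) : padicValNat q (q * n) = padicValNat q n + 1 := by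
  apply padicValNat_base_mul <;> omega

lemma pv_not (q n : ℕ) (h : ¬ q ∣ n) : padicValNat q n = 0 := padicValNat.eq_zero_of_not_dvd h

/-- Coefficients of the `s`-shifted series. -/
def cf (q k s n : ℕ) : ℤ :=
  if n = 0 then 0 else (((padicValNat q n + s) % k : ℕ) : ℤ) - ((s % k : ℕ) : ℤ)

noncomputable def G (q k s : ℕ) (z : ℂ) : ℂ := ∑' n, (cf q k s n : ℂ) * z ^ n

def dd (k m : ℕ) : ℤ := (((m + 1) % k : ℕ) : ℤ) - ((m % k : ℕ) : ℤ)

lemma cf_bound (q k s n : ℕ) (hk : 2 ≤ k) : ‖(cf q k s n : ℂ)‖ ≤ k := by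
  have h1 : |cf q k s n| ≤ (k : ℤ) := by
    unfold cf
    have a1 := Nat.mod_lt (padicValNat q n + s) (show k > 0 by omega)
    have a2 := Nat.mod_lt (s) (show k > 0 by omega)
    split_ifs
    · simp
    · rw [abs_le]; constructor <;> omega
  rw [Complex.norm_intCast]
  exact_mod_cast h1

lemma summ (q k s : ℕ) (hk : 2 ≤ k) (z : ℂ) (hz : ‖z‖ < 1) :
    Summable (fun n => (cf q k s n : ℂ) * z ^ n) := by
  refine Summable.of_norm_bounded (g := fun n => (k : ℝ) * ‖z‖ ^ n)
    ((summable_geometric_of_lt_one (norm_nonneg _) hz).mul_left _) ?_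
  intro n
  rw [norm_mul, norm_pow]
  gcongr
  exact cf_bound q k s n hk

lemma G_step (q k s : ℕ) (hq : 2 ≤ q) (hk : 2 ≤ k) (z : ℂ) (hz : ‖z‖ < 1) :
    G q k s z = dd k s * (z ^ q / (1 - z ^ q)) + G q k (s + 1) (z ^ q) := by
  have hzq : ‖z ^ q‖ < 1 := by
    rw [norm_pow]; exact pow_lt_one₀ (norm_nonneg _) hz (by omega)
  have h1 : G q k s z = ∑' n, (cf q k s (q * n) : ℂ) * z ^ (q * n) := by
    unfold G
    have hinj : Function.Injective (fun n : ℕ => q * n) := by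
      intro x y h
      exact Nat.eq_of_mul_eq_mul_left (by omega) h
    have := hinj.tsum_eq (f := fun n => (cf q k s n : ℂ) * z ^ n) ?_
    · rw [← this]
    · intro n hn
      by_contra hc
      apply hn
      have : ¬ q ∣ n := by
        rintro ⟨m, rfl⟩
        exact hc ⟨m, rfl⟩
      simp [cf, pv_not q n this]
  have hg : HasSum (fun n : ℕ => if n = 0 then (0 : ℂ) else (z ^ q) ^ n) (z ^ q / (1 - z ^ q)) := by
    have h2 := (hasSum_geometric_of_norm_lt_one hzq).mul_left (z ^ q)
    rw [← hasSum_nat_add_iff' 1]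
    simp only [Finset.sum_range_one, if_true, sub_zero]
    rw [div_eq_mul_inv]
    simpa [pow_succ'] using h2
  have h3 := (hg.mul_left (dd k s : ℂ)).add (summ q k (s + 1) hk (z ^ q) hzq).hasSum
  rw [h1]
  unfold G
  rw [← h3.tsum_eq]
  congr 1
  funext n
  rcases Nat.eq_zero_or_pos n with rfl | hn
  · simp [cf]
  · have : cf q k s (q * n) = dd k s + cf q k (s + 1) n := by
      have h4 : q * n ≠ 0 := by positivity
      simp only [cf, dd, h4, hn.ne', if_false, pv_mul q n hq hn.ne']
      rw [show padicValNat q n + 1 + s = padicValNat q n + (s + 1) by ring]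
      ring
    rw [this]
    simp only [hn.ne', if_false, pow_mul]
    push_cast
    ring

lemma G_iter (q k s : ℕ) (hq : 2 ≤ q) (hk : 2 ≤ k) (z : ℂ) (hz : ‖z‖ < 1) :
    G q k 0 z = ∑ m ∈ Finset.range s, (dd k m : ℂ) * (z ^ q ^ (m + 1) / (1 - z ^ q ^ (m + 1)))
      + G q k s (z ^ q ^ s) := by
  induction s with
  | zero => simp
  | succ s ih =>
    have hzq : ‖z ^ q ^ s‖ < 1 := by
      rw [norm_pow]; exact pow_lt_one₀ (norm_nonneg _) hz (by positivity)
    rw [ih, G_step q k s hq hk _ hzq, Finset.sum_range_succ, ← pow_mul, ← pow_succ]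
    ring

lemma G_per (q k n : ℕ) : G q k (k * n) = G q k 0 := by
  funext z
  unfold G
  congr 1
  funext m
  simp [cf]

lemma G_fun (q k n : ℕ) (hq : 2 ≤ q) (hk : 2 ≤ k) (z : ℂ) (hz : ‖z‖ < 1) :
    G q k 0 z = ∑ m ∈ Finset.range (k * n), (dd k m : ℂ) * (z ^ q ^ (m + 1) / (1 - z ^ q ^ (m + 1)))
      + G q k 0 (z ^ q ^ (k * n)) := by
  rw [G_iter q k (k * n) hq hk z hz, G_per]

lemma G_eq (q k : ℕ) (x : ℝ) :
    G q k 0 x = ((∑' n : ℕ, ((padicValNat q n % k : ℕ) : ℝ) * x ^ n : ℝ) : ℂ) := by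
  unfold G
  rw [Complex.ofReal_tsum]
  congr 1
  funext n
  rcases Nat.eq_zero_or_pos n with rfl | hn
  · simp [cf]
  · simp [cf, hn.ne']
    left
    norm_cast

lemma G_analytic (q k : ℕ) (hk : 2 ≤ k) : AnalyticOnNhd ℂ (G q k 0) (Metric.ball 0 1) := by
  apply DifferentiableOn.analyticOnNhd _ Metric.isOpen_ball
  intro z hz
  have hz' : ‖z‖ < 1 := by simpa using hz
  obtain ⟨r, hr1, hr2⟩ := exists_between hz'
  have hr0 : 0 ≤ r := (norm_nonneg _).trans hr1.le
  have := Complex.differentiableOn_tsum_of_summable_norm (U := Metric.ball (0 : ℂ) r)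
    (F := fun n z => (cf q k 0 n : ℂ) * z ^ n) (u := fun n => (k : ℝ) * r ^ n)
    ((summable_geometric_of_lt_one hr0 hr2).mul_left _) (fun n => by fun_prop) Metric.isOpen_ball
    (by
      intro n w hw
      have hw' : ‖w‖ < r := by simpa using hw
      rw [norm_mul, norm_pow]
      gcongr
      exact cf_bound q k 0 n hk)
  have h2 : DifferentiableAt ℂ (G q k 0) z :=
    this.differentiableAt (Metric.isOpen_ball.mem_nhds (by simpa using hr1))
  exact h2.differentiableWithinAt

/-- truncation -/
lemma G_trunc (q k N : ℕ) (hk : 2 ≤ k) (z : ℂ) (hz : ‖z‖ ≤ 1 / 2) :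
    ∃ h : ℂ, ‖h‖ ≤ 2 * k ∧
      G q k 0 z = ∑ n ∈ Finset.range N, (cf q k 0 n : ℂ) * z ^ n + z ^ N * h := by
  have hz1 : ‖z‖ < 1 := by linarith
  have hb : ∀ n, ‖(cf q k 0 (n + N) : ℂ) * z ^ n‖ ≤ (k : ℝ) * (1 / 2) ^ n := by
    intro n
    rw [norm_mul, norm_pow]
    gcongr
    exact cf_bound q k 0 _ hk
  have hs : HasSum (fun n : ℕ => (k : ℝ) * (1 / 2) ^ n) (k * 2) := by
    exact hasSum_geometric_two.mul_left _
  refine ⟨∑' n, (cf q k 0 (n + N) : ℂ) * z ^ n, ?_, ?_⟩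
  · rw [mul_comm]; exact tsum_of_norm_bounded hs hb
  · unfold G
    rw [← (summ q k 0 hk z hz1).sum_add_tsum_nat_add N, ← tsum_mul_left]
    congr 2
    funext n
    rw [pow_add]; ring

open Filter Topology in
lemma G_blow (q k : ℕ) (hq : 2 ≤ q) (hk : 2 ≤ k) :
    Tendsto (fun r : ℝ => ‖G q k 0 (r : ℂ)‖) (𝓝[<] 1) atTop := by
  set c : ℕ → ℝ := fun n => ((padicValNat q n % k : ℕ) : ℝ) with hc
  have hc0 : ∀ n, 0 ≤ c n := fun n => Nat.cast_nonneg _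
  have hns : ¬ Summable c := by
    intro h
    have h1 := h.tendsto_atTop_zero
    have h2 : Tendsto (fun t : ℕ => q * (1 + q * t)) atTop atTop := by
      apply tendsto_atTop_mono (f := fun t => t) _ tendsto_id
      intro t
      nlinarith [Nat.zero_le t, Nat.mul_le_mul hq (le_refl t), Nat.mul_le_mul hq (le_refl (q * t))]
    have h3 := h1.comp h2
    have h4 : (c ∘ fun t : ℕ => q * (1 + q * t)) = fun _ => (1 : ℝ) := by
      funext t
      have : ¬ q ∣ 1 + q * t := by
        intro hd
        have := (Nat.dvd_add_left (dvd_mul_right q t)).1 hd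
        have := Nat.dvd_one.1 this
        omega
      simp [hc, pv_mul q (1 + q * t) hq (Nat.add_pos_left one_pos _).ne', pv_not q _ this, Nat.mod_eq_of_lt (show 1 < k by omega)]
    rw [h4] at h3
    exact one_ne_zero (tendsto_nhds_unique tendsto_const_nhds h3)
  rw [not_summable_iff_tendsto_nat_atTop_of_nonneg hc0] at hns
  rw [tendsto_atTop]
  intro M
  obtain ⟨L, hL⟩ := (hns.eventually (eventually_ge_atTop (M + 1))).exists
  have hcont : Tendsto (fun r : ℝ => ∑ i ∈ Finset.range L, c i * r ^ i) (𝓝[<] 1)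
      (𝓝 (∑ i ∈ Finset.range L, c i * (1 : ℝ) ^ i)) := by
    apply Tendsto.mono_left _ nhdsWithin_le_nhds
    apply Continuous.tendsto
    fun_prop
  have h5 := hcont.eventually (eventually_gt_nhds (show M < _ by simp; linarith))
  have h6 : ∀ᶠ r : ℝ in 𝓝[<] 1, r ∈ Set.Ioo (0 : ℝ) 1 := Ioo_mem_nhdsLT (by norm_num)
  filter_upwards [h5, h6] with r hr1 hr2
  rw [G_eq, Complex.norm_real]
  refine le_trans ?_ (le_abs_self _)
  refine hr1.le.trans ?_
  apply Summable.sum_le_tsum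
  · intro i _
    exact mul_nonneg (hc0 i) (pow_nonneg hr2.1.le _)
  · refine Summable.of_nonneg_of_le (f := fun n => (k : ℝ) * r ^ n) ?_ ?_
      ((summable_geometric_of_lt_one hr2.1.le hr2.2).mul_left _)
    · intro i
      exact mul_nonneg (hc0 i) (pow_nonneg hr2.1.le _)
    · intro i
      have := hr2.1.le
      gcongr
      exact Nat.cast_le.2 (Nat.mod_lt (padicValNat q i) (show k > 0 by omega)).le

lemma G_rot (q k : ℕ) (z w : ℂ) (hw : w ^ q = 1) : G q k 0 (z * w) = G q k 0 z := by
  unfold G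
  congr 1
  funext n
  by_cases h : q ∣ n
  · obtain ⟨m, rfl⟩ := h
    rw [mul_pow, pow_mul w, hw, one_pow, mul_one]
  · simp [cf, pv_not q n h]

open Filter Topology in
lemma G_blow_root (q k n : ℕ) (hq : 2 ≤ q) (hk : 2 ≤ k) (ζ : ℂ)
    (hζ : IsPrimitiveRoot ζ (q ^ (k * n + 1))) :
    Tendsto (fun r : ℝ => ‖G q k 0 ((r : ℂ) * ζ)‖) (𝓝[<] 1) atTop := by
  have hn1 : ‖ζ‖ = 1 := hζ.norm'_eq_one (by positivity)
  set R : ℂ → ℂ := fun z => ∑ m ∈ Finset.range (k * n), (dd k m : ℂ) *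
    (z ^ q ^ (m + 1) / (1 - z ^ q ^ (m + 1))) with hR
  have hRc : Tendsto (fun r : ℝ => ‖R ((r : ℂ) * ζ)‖) (𝓝[<] 1) (𝓝 ‖R ((1 : ℝ) * ζ)‖) := by
    apply Tendsto.mono_left _ nhdsWithin_le_nhds
    apply ContinuousAt.tendsto (f := fun r : ℝ => ‖R ((r : ℂ) * ζ)‖)
    apply ContinuousAt.norm
    simp only [hR]
    apply tendsto_finsetSum
    intro m hm
    have hne : (1 : ℂ) - (((1 : ℝ) : ℂ) * ζ) ^ q ^ (m + 1) ≠ 0 := by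
      intro h
      have h1 : ζ ^ q ^ (m + 1) = 1 := by
        simp at h
        exact (sub_eq_zero.1 h).symm
      have h2 := (hζ.pow_eq_one_iff_dvd _).1 h1
      have h3 := (Nat.pow_dvd_pow_iff_le_right hq).1 h2
      have := Finset.mem_range.1 hm
      omega
    apply ContinuousAt.tendsto (f := fun r : ℝ => (dd k m : ℂ) *
      (((r : ℂ) * ζ) ^ q ^ (m + 1) / (1 - ((r : ℂ) * ζ) ^ q ^ (m + 1))))
    apply ContinuousAt.mul continuousAt_const
    exact ContinuousAt.div (f := fun r : ℝ => ((r : ℂ) * ζ) ^ q ^ (m + 1))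
      (g := fun r : ℝ => 1 - ((r : ℂ) * ζ) ^ q ^ (m + 1)) (by fun_prop) (by fun_prop) hne
  have hpow : Tendsto (fun r : ℝ => r ^ q ^ (k * n)) (𝓝[<] 1) (𝓝[<] 1) := by
    apply tendsto_nhdsWithin_of_tendsto_nhds_of_eventually_within
    · apply Tendsto.mono_left _ nhdsWithin_le_nhds
      have : Continuous (fun r : ℝ => r ^ q ^ (k * n)) := by fun_prop
      simpa using this.tendsto 1
    · have h6 : ∀ᶠ r : ℝ in 𝓝[<] 1, r ∈ Set.Ioo (0 : ℝ) 1 := Ioo_mem_nhdsLT (by norm_num)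
      filter_upwards [h6] with r hr
      exact pow_lt_one₀ hr.1.le hr.2 (by positivity)
  have h1 := (G_blow q k hq hk).comp hpow
  have h2 := h1.atTop_add hRc.neg
  refine tendsto_atTop_mono' _ ?_ h2
  have h6 : ∀ᶠ r : ℝ in 𝓝[<] 1, r ∈ Set.Ioo (0 : ℝ) 1 := Ioo_mem_nhdsLT (by norm_num)
  filter_upwards [h6] with r hr
  have hz : ‖(r : ℂ) * ζ‖ < 1 := by
    rw [norm_mul, hn1, mul_one, Complex.norm_real, Real.norm_eq_abs, abs_of_pos hr.1]; exact hr.2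
  have h7 := G_fun q k n hq hk _ hz
  rw [mul_pow (r : ℂ) ζ (q ^ (k * n)), G_rot q k _ (ζ ^ q ^ (k * n))
    (by rw [← pow_mul, ← pow_succ]; exact hζ.pow_eq_one)] at h7
  rw [h7]
  have h8 := norm_sub_norm_le (G q k 0 ((r : ℂ) ^ q ^ (k * n))) (-R ((r : ℂ) * ζ))
  rw [norm_neg, sub_neg_eq_add, add_comm (G q k 0 _)] at h8
  simp only [Function.comp, Complex.ofReal_pow]
  linarith

open Filter Topology in
lemma f_trans (q k : ℕ) (hq : 2 ≤ q) (hk : 2 ≤ k) (P : ℕ → ℂ[X]) (m : ℕ)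
    (h : ∀ z : ℂ, ‖z‖ < 1 → ∑ j ∈ Finset.range m, (P j).eval z * G q k 0 z ^ j = 0) :
    ∀ j < m, P j = 0 := by
  induction m with
  | zero => intro j hj; omega
  | succ m ih =>
    have hP : P m = 0 := by
      apply Polynomial.eq_zero_of_infinite_isRoot
      have hprim : ∀ n : ℕ, IsPrimitiveRoot
          (Complex.exp (2 * Real.pi * Complex.I / ((q ^ (k * n + 1) : ℕ) : ℂ))) (q ^ (k * n + 1)) :=
        fun n => Complex.isPrimitiveRoot_exp _ (by positivity)
      refine Set.infinite_of_injective_forall_mem (f := fun n : ℕ =>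
          (Complex.exp (2 * Real.pi * Complex.I / ((q ^ (k * n + 1) : ℕ) : ℂ)))) ?_ ?_
      · intro n1 n2 h12
        simp only at h12
        have e1 := hprim n1
        rw [h12] at e1
        have e2 := e1.unique (hprim n2)
        have e3 := Nat.pow_right_injective hq e2
        simp only [Nat.add_right_cancel_iff] at e3
        exact Nat.eq_of_mul_eq_mul_left (by omega) e3
      · intro n
        set ζ := Complex.exp (2 * Real.pi * Complex.I / ((q ^ (k * n + 1) : ℕ) : ℂ)) with hζ
        have hb := G_blow_root q k n hq hk ζ (hprim n)
        have hn1 : ‖ζ‖ = 1 := (hprim n).norm'_eq_one (by positivity)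
        have hg : Tendsto (fun r : ℝ => (G q k 0 ((r : ℂ) * ζ))⁻¹) (𝓝[<] 1) (𝓝 0) :=
          tendsto_inv₀_cobounded.comp (tendsto_norm_atTop_iff_cobounded.1 hb)
        have hev : ∀ Q : ℂ[X], Tendsto (fun r : ℝ => Q.eval ((r : ℂ) * ζ)) (𝓝[<] 1)
            (𝓝 (Q.eval ζ)) := by
          intro Q
          apply Tendsto.mono_left _ nhdsWithin_le_nhds
          have : Continuous (fun r : ℝ => Q.eval ((r : ℂ) * ζ)) := by fun_prop
          simpa using this.tendsto 1
        have hlim : Tendsto (fun r : ℝ => -∑ j ∈ Finset.range m, (P j).eval ((r : ℂ) * ζ) *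
            ((G q k 0 ((r : ℂ) * ζ))⁻¹) ^ (m - j)) (𝓝[<] 1) (𝓝 (-∑ j ∈ Finset.range m, 0)) := by
          apply Tendsto.neg
          apply tendsto_finsetSum
          intro j hj
          have hj' := Finset.mem_range.1 hj
          have := (hev (P j)).mul (hg.pow (m - j))
          rwa [zero_pow (by omega), mul_zero] at this
        simp only [Finset.sum_const_zero, neg_zero] at hlim
        have heq : (fun r : ℝ => -∑ j ∈ Finset.range m, (P j).eval ((r : ℂ) * ζ) *
            ((G q k 0 ((r : ℂ) * ζ))⁻¹) ^ (m - j)) =ᶠ[𝓝[<] 1]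
            (fun r : ℝ => (P m).eval ((r : ℂ) * ζ)) := by
          have h6 : ∀ᶠ r : ℝ in 𝓝[<] 1, r ∈ Set.Ioo (0 : ℝ) 1 := Ioo_mem_nhdsLT (by norm_num)
          filter_upwards [h6, hb.eventually (eventually_gt_atTop 0)] with r hr hr2
          have hz : ‖(r : ℂ) * ζ‖ < 1 := by
            rw [norm_mul, hn1, mul_one, Complex.norm_real, Real.norm_eq_abs, abs_of_pos hr.1]
            exact hr.2
          have h0 := h _ hz
          have hne : G q k 0 ((r : ℂ) * ζ) ≠ 0 := norm_pos_iff.1 hr2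
          set g := G q k 0 ((r : ℂ) * ζ)
          rw [Finset.sum_range_succ] at h0
          have hs : ∑ j ∈ Finset.range m, (P j).eval ((r : ℂ) * ζ) * g⁻¹ ^ (m - j) =
              (∑ j ∈ Finset.range m, (P j).eval ((r : ℂ) * ζ) * g ^ j) * (g ^ m)⁻¹ := by
            rw [Finset.sum_mul]
            apply Finset.sum_congr rfl
            intro j hj
            have hj' := Finset.mem_range.1 hj
            rw [mul_assoc]
            congr 1
            have : g ^ m = g ^ j * g ^ (m - j) := by rw [← pow_add]; congr 1; omega
            rw [this, inv_pow]
            field_simp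
          rw [hs, eq_neg_of_add_eq_zero_left h0]
          field_simp
        have := tendsto_nhds_unique (hlim.congr' heq) (hev (P m))
        exact this.symm
    intro j hj
    rcases Nat.lt_succ_iff_lt_or_eq.1 hj with h1 | rfl
    · apply ih _ j h1
      intro z hz
      have := h z hz
      rw [Finset.sum_range_succ, hP] at this
      simpa using this
    · exact hP

lemma liouville_bound_aux (K : Type) [Field K] [Algebra ℚ K] [FiniteDimensional ℚ K] (γ : K)
    (φ : K →ₐ[ℚ] ℂ) (β : ℂ) (hval : φ γ = β) :
    ∃ (M : ℝ) (D : ℕ), 0 ≤ M ∧ ∀ p : ℕ, ∃ C : ℝ, 0 < C ∧ ∀ (T : ℤ[X]) (H : ℝ), T.natDegree ≤ p → 1 ≤ H →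
      (∀ w : ℂ, ‖w‖ ≤ M → ‖aeval w T‖ ≤ H) → aeval β T ≠ 0 → 1 ≤ C * H ^ D * ‖aeval β T‖ := by
  have hγa : IsAlgebraic ℤ γ := by
    have : IsAlgebraic ℚ γ := Algebra.IsAlgebraic.isAlgebraic γ
    exact (IsFractionRing.isAlgebraic_iff ℤ ℚ K).2 this
  obtain ⟨L, hL0, hL⟩ := hγa.exists_integral_multiple
  refine ⟨∑ σ : K →ₐ[ℚ] ℂ, ‖σ γ‖, Fintype.card (K →ₐ[ℚ] ℂ),
    Finset.sum_nonneg (fun _ _ => norm_nonneg _), fun p => ?_⟩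
  set D := Fintype.card (K →ₐ[ℚ] ℂ)
  have hL1 : (1 : ℝ) ≤ ‖(L : ℂ)‖ ^ p := by
    apply one_le_pow₀
    rw [Complex.norm_intCast]
    exact_mod_cast Int.one_le_abs hL0
  refine ⟨‖(L : ℂ)‖ ^ p * (‖(L : ℂ)‖ ^ p) ^ D, by positivity, ?_⟩
  intro T H hT hH hbound hne
  set z : K := (L : K) ^ p * aeval γ T with hz
  have hzint : IsIntegral ℤ z := by
    have : z = ∑ i ∈ Finset.range (p + 1), ((T.coeff i * L ^ (p - i) : ℤ) : K) * (L • γ) ^ i := by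
      rw [hz, aeval_eq_sum_range' (Nat.lt_succ_of_le hT), Finset.mul_sum]
      apply Finset.sum_congr rfl
      intro i hi
      have hi' := Finset.mem_range.1 hi
      have : (L : K) ^ p = L ^ (p - i) * L ^ i := by rw [← pow_add]; congr 1; omega
      rw [this, zsmul_eq_mul, zsmul_eq_mul, mul_pow]
      push_cast
      ring
    rw [this]
    apply IsIntegral.sum
    intro i _
    apply IsIntegral.mul
    · exact isIntegral_algebraMap (R := ℤ) (x := T.coeff i * L ^ (p - i))
    · exact hL.pow i
  have hσ : ∀ σ : K →ₐ[ℚ] ℂ, σ z = (L : ℂ) ^ p * aeval (σ γ) T := by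
    intro σ
    rw [hz, map_mul, map_pow, map_intCast]
    congr 1
    exact (Polynomial.aeval_algHom_apply ((σ : K →+* ℂ).toIntAlgHom) γ T).symm
  have hz0 : z ≠ 0 := by
    intro h0
    have := hσ φ
    rw [h0, map_zero, hval] at this
    have hLc : (L : ℂ) ≠ 0 := by exact_mod_cast hL0
    exact mul_ne_zero (pow_ne_zero p hLc) hne this.symm
  have hnorm := Algebra.norm_eq_prod_embeddings ℚ ℂ z
  have hni : IsIntegral ℤ (Algebra.norm ℚ z) := Algebra.isIntegral_norm ℚ hzint
  obtain ⟨N, hN⟩ := IsIntegrallyClosed.isIntegral_iff.1 hni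
  have hN0 : N ≠ 0 := by
    rintro rfl
    apply hz0
    apply (Algebra.norm_eq_zero_iff (R := ℚ)).1
    rw [← hN]; simp
  have h1 : 1 ≤ ∏ σ : K →ₐ[ℚ] ℂ, ‖σ z‖ := by
    rw [← norm_prod, ← hnorm, ← hN]
    simp only [eq_intCast, map_intCast]
    rw [Complex.norm_intCast]
    exact_mod_cast Int.one_le_abs hN0
  classical
  rw [← Finset.mul_prod_erase Finset.univ _ (Finset.mem_univ φ)] at h1
  have h2 : ∏ σ ∈ Finset.univ.erase φ, ‖σ z‖ ≤ (‖(L : ℂ)‖ ^ p * H) ^ D := by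
    have hA : 1 ≤ ‖(L : ℂ)‖ ^ p * H := one_le_mul_of_one_le_of_one_le hL1 hH
    calc ∏ σ ∈ Finset.univ.erase φ, ‖σ z‖
        ≤ ∏ σ ∈ Finset.univ.erase φ, (‖(L : ℂ)‖ ^ p * H) := by
          apply Finset.prod_le_prod
          · intro σ _; exact norm_nonneg _
          · intro σ _
            rw [hσ, norm_mul, norm_pow]
            gcongr
            apply hbound
            exact Finset.single_le_sum (f := fun σ : K →ₐ[ℚ] ℂ => ‖σ γ‖)
              (fun _ _ => norm_nonneg _) (Finset.mem_univ σ)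
      _ = (‖(L : ℂ)‖ ^ p * H) ^ (Finset.univ.erase φ).card := by simp
      _ ≤ _ := pow_le_pow_right₀ hA (Finset.card_le_univ _)
  rw [hσ, hval, norm_mul, norm_pow] at h1
  calc (1 : ℝ) ≤ _ := h1
    _ ≤ ‖(L : ℂ)‖ ^ p * ‖aeval β T‖ * (‖(L : ℂ)‖ ^ p * H) ^ D := by gcongr
    _ = _ := by rw [mul_pow]; ring

open IntermediateField in
lemma liouville_bound (β : ℂ) (hβ : IsAlgebraic ℚ β) :
    ∃ (M : ℝ) (D : ℕ), 0 ≤ M ∧ ∀ p : ℕ, ∃ C : ℝ, 0 < C ∧ ∀ (T : ℤ[X]) (H : ℝ), T.natDegree ≤ p → 1 ≤ H →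
      (∀ w : ℂ, ‖w‖ ≤ M → ‖aeval w T‖ ≤ H) → aeval β T ≠ 0 → 1 ≤ C * H ^ D * ‖aeval β T‖ := by
  have hint : IsIntegral ℚ β := hβ.isIntegral
  have : FiniteDimensional ℚ ℚ⟮β⟯ := adjoin.finiteDimensional hint
  exact liouville_bound_aux ℚ⟮β⟯ (AdjoinSimple.gen ℚ β) (ℚ⟮β⟯).val β (AdjoinSimple.coe_gen ℚ β)

noncomputable def EE (q k p : ℕ) (c : Fin (p + 1) × Fin (p + 1) → ℤ) (z : ℂ) : ℂ :=
  ∑ ij, (c ij : ℂ) * (z ^ (ij.1 : ℕ) * G q k 0 z ^ (ij.2 : ℕ))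

lemma G_bd (q k : ℕ) (hk : 2 ≤ k) (z : ℂ) (hz : ‖z‖ ≤ 1 / 2) : ‖G q k 0 z‖ ≤ 2 * k := by
  obtain ⟨h, h1, h2⟩ := G_trunc q k 0 hk z hz
  simpa [h2] using h1

lemma siegel (q k p : ℕ) (hk : 2 ≤ k) :
    ∃ c : Fin (p + 1) × Fin (p + 1) → ℤ, c ≠ 0 ∧ ∃ K : ℝ, 0 ≤ K ∧
      ∀ z : ℂ, ‖z‖ ≤ 1 / 2 → ‖EE q k p c z‖ ≤ K * ‖z‖ ^ (p ^ 2) := by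
  set N := p ^ 2 with hN
  set t : ℤ[X] := ∑ n ∈ Finset.range N, C (cf q k 0 n) * X ^ n with ht
  let W : (Fin (p + 1) × Fin (p + 1) → ℤ) → ℤ[X] := fun c =>
    ∑ ij, c ij • (X ^ (ij.1 : ℕ) * t ^ (ij.2 : ℕ))
  let Φ : (Fin (p + 1) × Fin (p + 1) → ℤ) →ₗ[ℤ] (Fin N → ℤ) :=
    { toFun := fun c l => (W c).coeff l
      map_add' := by
        intro c d
        funext l
        simp [W, add_mul, Finset.sum_add_distrib]
      map_smul' := by
        intro r c
        funext l
        simp [W, mul_assoc, Finset.mul_sum] }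
  have hni : ¬ Function.Injective Φ := by
    intro h
    have := card_le_of_injective ℤ Φ h
    simp at this
    nlinarith
  rw [injective_iff_map_eq_zero] at hni
  push Not at hni
  obtain ⟨c, hc, hc0⟩ := hni
  have hdvd : X ^ N ∣ W c := by
    rw [X_pow_dvd_iff]
    intro d hd
    exact congrFun hc ⟨d, hd⟩
  obtain ⟨V, hV⟩ := hdvd
  obtain ⟨BV, hBV⟩ := (isCompact_closedBall (0 : ℂ) (1 / 2)).exists_bound_of_continuousOn
    (f := fun z : ℂ => aeval z V) (by fun_prop)
  have hBV0 : 0 ≤ BV := (norm_nonneg _).trans (hBV 0 (by simp))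
  have htz : ∀ z : ℂ, aeval z t = ∑ n ∈ Finset.range N, (cf q k 0 n : ℂ) * z ^ n := by
    intro z; simp [ht]
  have hdiff : ∀ z : ℂ, ‖z‖ ≤ 1 / 2 → ‖G q k 0 z - aeval z t‖ ≤ 2 * k * ‖z‖ ^ N := by
    intro z hz
    obtain ⟨h, h1, h2⟩ := G_trunc q k N hk z hz
    rw [h2, htz, add_sub_cancel_left, norm_mul, norm_pow, mul_comm]
    gcongr
  have htb : ∀ z : ℂ, ‖z‖ ≤ 1 / 2 → ‖aeval z t‖ ≤ 4 * k := by
    intro z hz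
    have h1 := hdiff z hz
    have h2 := G_bd q k hk z hz
    have h3 : ‖aeval z t‖ ≤ ‖G q k 0 z‖ + ‖G q k 0 z - aeval z t‖ := by
      have := norm_sub_le (G q k 0 z) (G q k 0 z - aeval z t)
      simpa using this
    have h4 : ‖z‖ ^ N ≤ 1 := pow_le_one₀ (norm_nonneg _) (by linarith)
    have : (2 : ℝ) * k * ‖z‖ ^ N ≤ 2 * k * 1 := by gcongr
    linarith
  have hB : ∀ j : ℕ, ∃ B : ℝ, 0 ≤ B ∧ ∀ z : ℂ, ‖z‖ ≤ 1 / 2 →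
      ‖G q k 0 z ^ j - (aeval z t) ^ j‖ ≤ B * ‖z‖ ^ N := by
    intro j
    induction j with
    | zero => exact ⟨0, le_rfl, fun z _ => by simp⟩
    | succ j ih =>
      obtain ⟨B, hB0, hB⟩ := ih
      refine ⟨2 * k * B + (4 * k) ^ j * (2 * k), by positivity, fun z hz => ?_⟩
      have : G q k 0 z ^ (j + 1) - (aeval z t) ^ (j + 1) =
        G q k 0 z * (G q k 0 z ^ j - (aeval z t) ^ j) + (aeval z t) ^ j * (G q k 0 z - aeval z t) := by
        ring
      rw [this]
      refine (norm_add_le _ _).trans ?_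
      rw [norm_mul, norm_mul, norm_pow, add_mul, mul_assoc (2 * (k : ℝ)), mul_assoc ((4 * (k : ℝ)) ^ j)]
      gcongr
      · exact G_bd q k hk z hz
      · exact hB z hz
      · exact htb z hz
      · exact hdiff z hz
  choose B hB0 hB using hB
  refine ⟨c, hc0, BV + ∑ ij, ‖(c ij : ℂ)‖ * B ij.2, ?_, ?_⟩
  · exact add_nonneg hBV0 (Finset.sum_nonneg fun ij _ => mul_nonneg (norm_nonneg _) (hB0 _))
  intro z hz
  have hsplit : EE q k p c z = aeval z (W c) + ∑ ij, (c ij : ℂ) * (z ^ (ij.1 : ℕ) *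
      (G q k 0 z ^ (ij.2 : ℕ) - (aeval z t) ^ (ij.2 : ℕ))) := by
    have : aeval z (W c) = ∑ ij, (c ij : ℂ) * (z ^ (ij.1 : ℕ) * (aeval z t) ^ (ij.2 : ℕ)) := by
      simp only [W, map_sum, map_mul, map_pow, aeval_X, zsmul_eq_mul, map_intCast]
    rw [this, ← Finset.sum_add_distrib]
    unfold EE
    apply Finset.sum_congr rfl
    intro ij _
    ring
  rw [hsplit, add_mul, Finset.sum_mul]
  refine (norm_add_le _ _).trans (add_le_add ?_ ((norm_sum_le _ _).trans (Finset.sum_le_sum ?_)))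
  · rw [hV, map_mul, map_pow, aeval_X, norm_mul, norm_pow, mul_comm]
    gcongr
    exact hBV z (by simpa using hz)
  · intro ij _
    rw [norm_mul, norm_mul, norm_pow, mul_assoc]
    apply mul_le_mul_of_nonneg_left _ (norm_nonneg _)
    have h1 : ‖z‖ ^ (ij.1 : ℕ) ≤ 1 := pow_le_one₀ (norm_nonneg _) (by linarith)
    calc _ ≤ 1 * ‖G q k 0 z ^ (ij.2 : ℕ) - (aeval z t) ^ (ij.2 : ℕ)‖ := by gcongr
      _ ≤ _ := by rw [one_mul]; exact hB _ z hz

lemma EE_analytic (q k p : ℕ) (hk : 2 ≤ k) (c : Fin (p + 1) × Fin (p + 1) → ℤ) :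
    AnalyticOnNhd ℂ (EE q k p c) (Metric.ball 0 1) := by
  unfold EE
  apply Finset.analyticOnNhd_fun_sum
  intro ij _
  exact analyticOnNhd_const.mul ((analyticOnNhd_id.pow _).mul ((G_analytic q k hk).pow _))

lemma EE_ne (q k p : ℕ) (hq : 2 ≤ q) (hk : 2 ≤ k) (c : Fin (p + 1) × Fin (p + 1) → ℤ)
    (h : ∀ z : ℂ, ‖z‖ < 1 → EE q k p c z = 0) : c = 0 := by
  let P : ℕ → ℂ[X] := fun j => if hj : j < p + 1 then
    ∑ i : Fin (p + 1), C (c (i, ⟨j, hj⟩) : ℂ) * X ^ (i : ℕ) else 0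
  have hP := f_trans q k hq hk P (p + 1) (by
    intro z hz
    rw [← h z hz, Finset.sum_range]
    unfold EE
    rw [Fintype.sum_prod_type_right]
    apply Finset.sum_congr rfl
    intro j _
    simp only [P, j.2, dif_pos, eval_finsetSum, Finset.sum_mul]
    apply Finset.sum_congr rfl
    intro i _
    simp [mul_assoc])
  funext ⟨i, j⟩
  have h1 := hP j j.2
  simp only [P, j.2, dif_pos] at h1
  have h2 := congrArg (fun Q => Q.coeff (i : ℕ)) h1
  simp [coeff_X_pow, Fin.val_inj] at h2
  simpa using h2

lemma rat_sum (q k s a b : ℕ) (hq : 2 ≤ q) (hab : a < b) :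
    ∃ U : ℤ, ∑ m ∈ Finset.range s, (dd k m : ℂ) *
      (((a : ℂ) / b) ^ q ^ (m + 1) / (1 - ((a : ℂ) / b) ^ q ^ (m + 1))) =
      (U : ℂ) / (((b : ℤ) ^ q ^ s - (a : ℤ) ^ q ^ s : ℤ) : ℂ) := by
  have hpos : ∀ e : ℕ, e ≠ 0 → (0 : ℤ) < (b : ℤ) ^ e - (a : ℤ) ^ e := by
    intro e he
    have : a ^ e < b ^ e := Nat.pow_lt_pow_left hab he
    have : (a : ℤ) ^ e < (b : ℤ) ^ e := by exact_mod_cast this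
    linarith
  apply Finset.sum_induction _ (fun y : ℂ => ∃ U : ℤ, y = (U : ℂ) / (((b : ℤ) ^ q ^ s - (a : ℤ) ^ q ^ s : ℤ) : ℂ))
  · rintro _ _ ⟨U, rfl⟩ ⟨V, rfl⟩
    exact ⟨U + V, by push_cast; ring⟩
  · exact ⟨0, by simp⟩
  · intro m hm
    have hm' := Finset.mem_range.1 hm
    set e := q ^ (m + 1) with he
    have he0 : e ≠ 0 := by positivity
    have hdv : (b : ℤ) ^ e - (a : ℤ) ^ e ∣ (b : ℤ) ^ q ^ s - (a : ℤ) ^ q ^ s := by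
      obtain ⟨d, hd⟩ := pow_dvd_pow q (show m + 1 ≤ s by omega)
      rw [hd, pow_mul, pow_mul]
      exact sub_dvd_pow_sub_pow _ _ _
    obtain ⟨d, hd⟩ := hdv
    have h1 := hpos e he0
    have h2 := hpos (q ^ s) (by positivity)
    have hd0 : d ≠ 0 := by
      rintro rfl
      rw [mul_zero] at hd
      omega
    refine ⟨dd k m * (a : ℤ) ^ e * d, ?_⟩
    rw [hd]
    have hb : (b : ℂ) ≠ 0 := by
      have : b ≠ 0 := by omega
      exact_mod_cast this
    have h1c : ((b : ℂ) ^ e - (a : ℂ) ^ e) ≠ 0 := by exact_mod_cast h1.ne'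
    have hdc : (d : ℂ) ≠ 0 := by exact_mod_cast hd0
    have h3 : 1 - ((a : ℂ) / b) ^ e = ((b : ℂ) ^ e - (a : ℂ) ^ e) / (b : ℂ) ^ e := by
      rw [div_pow]; field_simp
    rw [h3, div_pow]
    push_cast
    field_simp

lemma step_bound (q k a b : ℕ) (hq : 2 ≤ q) (hk : 2 ≤ k) (ha : 0 < a) (hab : a < b)
    (p : ℕ) (c : Fin (p + 1) × Fin (p + 1) → ℤ) (K : ℝ)
    (hE : ∀ z : ℂ, ‖z‖ ≤ 1 / 2 → ‖EE q k p c z‖ ≤ K * ‖z‖ ^ (p ^ 2))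
    (M : ℝ) (hM : 0 ≤ M) (D : ℕ) (C0 : ℝ) (hC0 : 0 < C0)
    (hT : ∀ (T : ℤ[X]) (H : ℝ), T.natDegree ≤ p → 1 ≤ H →
      (∀ w : ℂ, ‖w‖ ≤ M → ‖aeval w T‖ ≤ H) → aeval (G q k 0 ((a : ℂ) / b)) T ≠ 0 →
        1 ≤ C0 * H ^ D * ‖aeval (G q k 0 ((a : ℂ) / b)) T‖) :
    ∃ C1 : ℝ, ∀ n : ℕ, ‖((a : ℂ) / b) ^ q ^ (k * n)‖ ≤ 1 / 2 →
      EE q k p c (((a : ℂ) / b) ^ q ^ (k * n)) ≠ 0 →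
      1 ≤ C1 * ((b : ℝ) ^ (2 * p * (D + 1)) * ((a : ℝ) / b) ^ (p ^ 2)) ^ q ^ (k * n) := by
  have hb0 : (0 : ℝ) < b := by exact_mod_cast (by omega : 0 < b)
  have hbc : (b : ℂ) ≠ 0 := by exact_mod_cast (by omega : b ≠ 0)
  have hρ : ‖(a : ℂ) / b‖ = (a : ℝ) / b := by simp
  have hρ1 : ‖(a : ℂ) / b‖ < 1 := by
    rw [hρ, div_lt_one hb0]; exact_mod_cast hab
  set β := G q k 0 ((a : ℂ) / b) with hβ
  set A : ℝ := 1 + M + ‖β‖ + 2 * k with hA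
  have hA1 : 1 ≤ A := by
    have := norm_nonneg β
    have : (0 : ℝ) ≤ k := Nat.cast_nonneg k
    linarith
  set H0 : ℝ := (1 + ∑ ij, ‖(c ij : ℂ)‖) * A ^ p with hH0
  have hsum0 : 0 ≤ ∑ ij, ‖(c ij : ℂ)‖ := Finset.sum_nonneg fun _ _ => norm_nonneg _
  have hH01 : 1 ≤ H0 := one_le_mul_of_one_le_of_one_le (by linarith) (one_le_pow₀ hA1)
  refine ⟨C0 * H0 ^ D * K, fun n hx hne => ?_⟩
  set S := q ^ (k * n) with hS
  have hS0 : S ≠ 0 := by positivity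
  set x : ℂ := ((a : ℂ) / b) ^ S with hxd
  set y := G q k 0 x with hy
  have hyb : ‖y‖ ≤ 2 * k := G_bd q k hk x hx
  obtain ⟨U, hU⟩ := rat_sum q k (k * n) a b hq hab
  have hfun := G_fun q k n hq hk _ hρ1
  rw [hU] at hfun
  set Q : ℤ := (b : ℤ) ^ S - (a : ℤ) ^ S with hQ
  have hQ0 : 0 < Q := by
    have : a ^ S < b ^ S := Nat.pow_lt_pow_left hab hS0
    have : (a : ℤ) ^ S < (b : ℤ) ^ S := by exact_mod_cast this
    linarith
  have hQc : (Q : ℂ) ≠ 0 := by exact_mod_cast hQ0.ne'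
  have hβe : β = U / Q + y := hfun
  have hQβ : (Q : ℂ) * β - U = Q * y := by rw [hβe]; field_simp; ring
  set Qr : ℝ := (Q : ℝ) with hQr
  have hQn : ‖(Q : ℂ)‖ = Qr := by
    rw [Complex.norm_intCast, abs_of_pos]; exact_mod_cast hQ0
  have hQr0 : 0 < Qr := Int.cast_pos.2 hQ0
  set Bn : ℝ := (b : ℝ) ^ S with hBn
  have hBn1 : 1 ≤ Bn := one_le_pow₀ (by exact_mod_cast (by omega : 1 ≤ b))
  have hQB : Qr ≤ Bn := by
    have : Qr = (b : ℝ) ^ S - (a : ℝ) ^ S := by rw [hQr, hQ]; push_cast; rfl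
    have h2 : (0 : ℝ) ≤ (a : ℝ) ^ S := by positivity
    rw [this]; linarith
  have haB : (a : ℝ) ^ S ≤ Bn := by
    apply pow_le_pow_left₀ (by positivity); exact_mod_cast hab.le
  let T : ℤ[X] := ∑ ij : Fin (p + 1) × Fin (p + 1),
    C (c ij * ((b : ℤ) ^ S) ^ (p - (ij.1 : ℕ)) * ((a : ℤ) ^ S) ^ (ij.1 : ℕ) * Q ^ (p - (ij.2 : ℕ))) *
      (C Q * X - C U) ^ (ij.2 : ℕ)
  have hTdeg : T.natDegree ≤ p := by
    apply natDegree_sum_le_of_forall_le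
    intro ij _
    refine (natDegree_C_mul_le _ _).trans ?_
    refine natDegree_pow_le.trans ?_
    have h1 : (C Q * X - C U).natDegree ≤ 1 := by
      rw [natDegree_sub_C]
      exact (natDegree_C_mul_le Q X).trans natDegree_X_le
    have h2 : (ij.2 : ℕ) ≤ p := Nat.lt_succ_iff.1 ij.2.2
    nlinarith
  have hTev : ∀ w : ℂ, aeval w T = ∑ ij : Fin (p + 1) × Fin (p + 1),
      ((c ij : ℂ) * ((b : ℂ) ^ S) ^ (p - (ij.1 : ℕ)) * ((a : ℂ) ^ S) ^ (ij.1 : ℕ) *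
        (Q : ℂ) ^ (p - (ij.2 : ℕ))) * ((Q : ℂ) * w - U) ^ (ij.2 : ℕ) := by
    intro w
    simp only [T, map_sum, map_mul, map_pow, map_sub, aeval_X, eq_intCast,
      map_natCast, map_intCast]
  have hTβ : aeval β T = ((b : ℂ) ^ S) ^ p * (Q : ℂ) ^ p * EE q k p c x := by
    rw [hTev, hQβ]
    unfold EE
    rw [Finset.mul_sum]
    apply Finset.sum_congr rfl
    intro ij _
    have h1 : (ij.1 : ℕ) ≤ p := Nat.lt_succ_iff.1 ij.1.2
    have h2 : (ij.2 : ℕ) ≤ p := Nat.lt_succ_iff.1 ij.2.2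
    have e1 : ((b : ℂ) ^ S) ^ p = ((b : ℂ) ^ S) ^ (p - (ij.1 : ℕ)) * ((b : ℂ) ^ S) ^ (ij.1 : ℕ) := by
      rw [← pow_add]; congr 1; omega
    have e2 : (Q : ℂ) ^ p = (Q : ℂ) ^ (p - (ij.2 : ℕ)) * (Q : ℂ) ^ (ij.2 : ℕ) := by
      rw [← pow_add]; congr 1; omega
    have e3 : ((a : ℂ) ^ S) ^ (ij.1 : ℕ) = ((b : ℂ) ^ S) ^ (ij.1 : ℕ) * x ^ (ij.1 : ℕ) := by
      rw [← mul_pow, hxd, div_pow]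
      congr 1
      field_simp
    rw [e1, e2, e3, mul_pow, ← hy]
    ring
  have hTb : ∀ w : ℂ, ‖w‖ ≤ M → ‖aeval w T‖ ≤ H0 * Bn ^ (2 * p) := by
    intro w hw
    have hw1 : ‖(Q : ℂ) * w - U‖ ≤ Qr * A := by
      have : (Q : ℂ) * w - U = Q * (w - β + y) := by
        have : (Q : ℂ) * w - U = Q * (w - β) + (Q * β - U) := by ring
        rw [this, hQβ]; ring
      rw [this, norm_mul, hQn]
      gcongr
      have h1 := norm_add_le (w - β) y
      have h2 := norm_sub_le w β
      rw [hA]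
      linarith
    rw [hTev]
    have hterm : ∀ ij : Fin (p + 1) × Fin (p + 1), ‖((c ij : ℂ) * ((b : ℂ) ^ S) ^ (p - (ij.1 : ℕ)) *
        ((a : ℂ) ^ S) ^ (ij.1 : ℕ) * (Q : ℂ) ^ (p - (ij.2 : ℕ))) * ((Q : ℂ) * w - U) ^ (ij.2 : ℕ)‖ ≤
        ‖(c ij : ℂ)‖ * (A ^ p * Bn ^ (2 * p)) := by
      intro ij
      have h1 : (ij.1 : ℕ) ≤ p := Nat.lt_succ_iff.1 ij.1.2
      have h2 : (ij.2 : ℕ) ≤ p := Nat.lt_succ_iff.1 ij.2.2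
      simp only [norm_mul, norm_pow, hQn, Complex.norm_natCast]
      calc ‖(c ij : ℂ)‖ * ((b : ℝ) ^ S) ^ (p - (ij.1 : ℕ)) * ((a : ℝ) ^ S) ^ (ij.1 : ℕ) *
            Qr ^ (p - (ij.2 : ℕ)) * ‖(Q : ℂ) * w - U‖ ^ (ij.2 : ℕ)
          ≤ ‖(c ij : ℂ)‖ * Bn ^ (p - (ij.1 : ℕ)) * Bn ^ (ij.1 : ℕ) *
            Bn ^ (p - (ij.2 : ℕ)) * (Bn * A) ^ (ij.2 : ℕ) := by
            have hw2 : ‖(Q : ℂ) * w - U‖ ≤ Bn * A := hw1.trans (by gcongr)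
            gcongr
        _ = ‖(c ij : ℂ)‖ * (A ^ (ij.2 : ℕ) * ((Bn ^ (p - (ij.1 : ℕ)) * Bn ^ (ij.1 : ℕ)) *
            (Bn ^ (p - (ij.2 : ℕ)) * Bn ^ (ij.2 : ℕ)))) := by rw [mul_pow]; ring
        _ = ‖(c ij : ℂ)‖ * (A ^ (ij.2 : ℕ) * Bn ^ (2 * p)) := by
            rw [← pow_add, ← pow_add, ← pow_add]; congr 3; omega
        _ ≤ _ := by gcongr
    calc _ ≤ ∑ ij, ‖(c ij : ℂ)‖ * (A ^ p * Bn ^ (2 * p)) :=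
          (norm_sum_le _ _).trans (Finset.sum_le_sum fun ij _ => hterm ij)
      _ = (∑ ij, ‖(c ij : ℂ)‖) * (A ^ p * Bn ^ (2 * p)) := by rw [Finset.sum_mul]
      _ ≤ (1 + ∑ ij, ‖(c ij : ℂ)‖) * (A ^ p * Bn ^ (2 * p)) := by gcongr; linarith
      _ = _ := by rw [hH0]; ring
  have hH1 : 1 ≤ H0 * Bn ^ (2 * p) := one_le_mul_of_one_le_of_one_le hH01 (one_le_pow₀ hBn1)
  have hTne : aeval β T ≠ 0 := by
    rw [hTβ]
    exact mul_ne_zero (mul_ne_zero (pow_ne_zero _ (pow_ne_zero _ hbc)) (pow_ne_zero _ hQc)) hne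
  have hfin := hT T _ hTdeg hH1 hTb hTne
  have hTβn : ‖aeval β T‖ ≤ Bn ^ (2 * p) * (K * (((a : ℝ) / b) ^ S) ^ (p ^ 2)) := by
    rw [hTβ]
    simp only [norm_mul, norm_pow, hQn, Complex.norm_natCast]
    have hEx := hE x hx
    rw [hxd, norm_pow, hρ, ← hxd] at hEx
    calc ((b : ℝ) ^ S) ^ p * Qr ^ p * ‖EE q k p c x‖ ≤ Bn ^ p * Bn ^ p * ‖EE q k p c x‖ := by gcongr
      _ = Bn ^ (2 * p) * ‖EE q k p c x‖ := by rw [← pow_add]; congr 2; omega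
      _ ≤ _ := by gcongr
  calc (1 : ℝ) ≤ _ := hfin
    _ ≤ C0 * (H0 * Bn ^ (2 * p)) ^ D * (Bn ^ (2 * p) * (K * (((a : ℝ) / b) ^ S) ^ (p ^ 2))) := by
        gcongr
    _ = C0 * H0 ^ D * K * ((Bn ^ (2 * p * (D + 1))) * (((a : ℝ) / b) ^ S) ^ (p ^ 2)) := by
        rw [mul_pow, ← pow_mul]; ring
    _ = _ := by
        congr 1
        rw [hBn, mul_pow, ← pow_mul, ← pow_mul, ← pow_mul, ← pow_mul]
        rw [mul_comm S, mul_comm S]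

open Filter Topology in
lemma main_trans (q k a b : ℕ) (hq : 2 ≤ q) (hk : 2 ≤ k) (ha : 0 < a) (hab : a < b) :
    ¬ IsAlgebraic ℚ (G q k 0 ((a : ℂ) / b)) := by
  intro halg
  obtain ⟨M, D, hM, hL⟩ := liouville_bound _ halg
  have hb0 : (0 : ℝ) < b := by exact_mod_cast (by omega : 0 < b)
  have ha0 : (0 : ℝ) < a := by exact_mod_cast ha
  set ρ : ℝ := (a : ℝ) / b with hρd
  have hρ0 : 0 < ρ := by positivity
  have hρ1 : ρ < 1 := by rw [hρd, div_lt_one hb0]; exact_mod_cast hab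
  have hρ : ‖(a : ℂ) / b‖ = ρ := by simp [hρd]
  obtain ⟨p, hp1, hp⟩ : ∃ p : ℕ, 1 ≤ p ∧ (b : ℝ) ^ (2 * (D + 1)) * ρ ^ p < 1 := by
    have h1 : Tendsto (fun p : ℕ => (b : ℝ) ^ (2 * (D + 1)) * ρ ^ p) atTop (𝓝 0) := by
      simpa using (tendsto_pow_atTop_nhds_zero_of_lt_one hρ0.le hρ1).const_mul ((b : ℝ) ^ (2 * (D + 1)))
    obtain ⟨p, h2, h3⟩ := ((eventually_ge_atTop 1).and (h1.eventually (eventually_lt_nhds one_pos))).exists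
    exact ⟨p, h2, h3⟩
  obtain ⟨C0, hC0, hT⟩ := hL p
  obtain ⟨c, hc, K, hK, hE⟩ := siegel q k p hk
  obtain ⟨C1, hC1⟩ := step_bound q k a b hq hk ha hab p c K hE M hM D C0 hC0 hT
  set θ : ℝ := (b : ℝ) ^ (2 * p * (D + 1)) * ρ ^ (p ^ 2) with hθ
  have hθ1 : θ < 1 := by
    have : θ = ((b : ℝ) ^ (2 * (D + 1)) * ρ ^ p) ^ p := by
      rw [hθ, mul_pow, ← pow_mul, ← pow_mul, sq]
      congr 2; ring
    rw [this]
    exact pow_lt_one₀ (by positivity) hp (by omega)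
  have hθ0 : 0 ≤ θ := by positivity
  have hStend : Tendsto (fun n : ℕ => q ^ (k * n)) atTop atTop := by
    apply tendsto_atTop_mono (f := fun n => n) _ tendsto_id
    intro n
    have h1 : k * n < q ^ (k * n) := Nat.lt_pow_self (by omega)
    nlinarith
  have hx0 : Tendsto (fun n : ℕ => ((a : ℂ) / b) ^ q ^ (k * n)) atTop (𝓝 0) :=
    (tendsto_pow_atTop_nhds_zero_of_norm_lt_one (by rw [hρ]; exact hρ1)).comp hStend
  have hne0 : ∀ n : ℕ, ((a : ℂ) / b) ^ q ^ (k * n) ≠ 0 := by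
    intro n
    apply pow_ne_zero
    rw [← norm_ne_zero_iff, hρ]
    exact hρ0.ne'
  have hx0' : Tendsto (fun n : ℕ => ((a : ℂ) / b) ^ q ^ (k * n)) atTop (𝓝[≠] 0) :=
    tendsto_nhdsWithin_of_tendsto_nhds_of_eventually_within _ hx0 (Eventually.of_forall hne0)
  have hfreq : ∃ᶠ n : ℕ in atTop, EE q k p c (((a : ℂ) / b) ^ q ^ (k * n)) ≠ 0 := by
    intro hev
    apply hc
    apply EE_ne q k p hq hk c
    have hz : ∃ᶠ z in 𝓝[≠] (0 : ℂ), EE q k p c z = 0 := by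
      apply hx0'.frequently
      apply Eventually.frequently
      filter_upwards [hev] with n hn
      exact not_not.1 hn
    have := (EE_analytic q k p hk c).eqOn_zero_of_preconnected_of_frequently_eq_zero
      (convex_ball (0 : ℂ) 1).isPreconnected (Metric.mem_ball_self one_pos) hz
    intro z hz1
    exact this (by simpa using hz1)
  have hsmall : ∀ᶠ n : ℕ in atTop, ‖((a : ℂ) / b) ^ q ^ (k * n)‖ ≤ 1 / 2 := by
    have h1 := hx0.norm
    rw [norm_zero] at h1
    exact h1.eventually (eventually_le_nhds (by norm_num))
  have hlim : Tendsto (fun n : ℕ => C1 * θ ^ q ^ (k * n)) atTop (𝓝 0) := by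
    simpa using ((tendsto_pow_atTop_nhds_zero_of_lt_one hθ0 hθ1).comp hStend).const_mul C1
  obtain ⟨n, h1, h2, h3⟩ :=
    (hfreq.and_eventually (hsmall.and (hlim.eventually (eventually_lt_nhds one_pos)))).exists
  exact absurd (hC1 n h2 h1) (not_le.2 h3)

end MahlerV

/-- Let `a`, `b` be relatively prime positive integers with `a/b < 1`, let
`k ≥ 2`, and let `q ≥ 2` be an integer with `q > 2·log b / (log b − log a)`. Then the real
number `V_{q,k}(a/b) = ∑_{n ≥ 1} (ν_q(n) mod k)·(a/b)ⁿ` is transcendental over `ℚ`. -/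
theorem Vqk_rational_value_transcendental (q k a b : ℕ) (hq : 2 ≤ q) (hk : 2 ≤ k)
    (ha : 0 < a) (hb : 0 < b) (hab : Nat.Coprime a b) (hlt : (a : ℝ) / b < 1)
    (hcond : 2 * Real.log b / (Real.log b - Real.log a) < q) :
    Transcendental ℚ (∑' n : ℕ, ((padicValNat q n % k : ℕ) : ℝ) * ((a : ℝ) / b) ^ n) := by
  intro halg
  have hlt' : a < b := by
    rw [div_lt_one (by exact_mod_cast hb)] at hlt
    exact_mod_cast hlt
  apply MahlerV.main_trans q k a b hq hk ha hlt'
  have h2 := halg.algebraMap (A := ℂ)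
  have h3 : ((a : ℂ) / b) = (((a : ℝ) / b : ℝ) : ℂ) := by push_cast; rfl
  rw [h3, MahlerV.G_eq]
  exact h2
end

section
/- Let a and b be relatively prime positive integers with a/b < 1, and let q ≥ 2 be an integer satisfying q > 2·log b / (log b − log a). Let ℓ ≥ 1 and 0 ≤ h ≤ q^ℓ − 1 be integers and set ω = exp(2πih/q^ℓ). Then the complex number V_q(ω·a/b) = ∑_{n≥1} ν_q(n)·(ω·a/b)^n is transcendental over ℚ. -/
open Filter Topology

lemma pv_mul (q : ℕ) (hq : 2 ≤ q) (m : ℕ) (hm : 0 < m) :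
    padicValNat q (q * m) = padicValNat q m + 1 := by
  have h1 : q ≠ 1 := by omega
  have hf : ∀ n, 0 < n → FiniteMultiplicity q n := fun n hn =>
    Nat.finiteMultiplicity_iff.2 ⟨h1, hn⟩
  rw [padicValNat_def' h1 (by positivity), padicValNat_def' h1 (by omega)]
  apply multiplicity_eq_of_emultiplicity_eq_some
  have h2 := (hf m hm).emultiplicity_eq_multiplicity
  set k := multiplicity q m
  rw [emultiplicity_eq_coe] at h2 ⊢
  refine ⟨?_, ?_⟩
  · rw [pow_succ, mul_comm]
    exact Nat.mul_dvd_mul_left q h2.1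
  · intro h
    apply h2.2
    rw [pow_succ, mul_comm] at h
    exact Nat.dvd_of_mul_dvd_mul_left (by omega) h

lemma pv_le (q : ℕ) (n : ℕ) : padicValNat q n ≤ n :=
  (padicValNat_le_nat_log n).trans (Nat.log_le_self q n)

noncomputable def VF (q : ℕ) (z : ℂ) : ℂ := ∑' n : ℕ, (padicValNat q n : ℂ) * z ^ n

lemma VF_bound (q : ℕ) (n : ℕ) (z : ℂ) (r : ℝ) (h : ‖z‖ ≤ r) :
    ‖(padicValNat q n : ℂ) * z ^ n‖ ≤ n * r ^ n := by
  rw [norm_mul, norm_pow, Complex.norm_natCast]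
  gcongr
  exact pv_le q n

lemma summable_nr (r : ℝ) (h0 : 0 ≤ r) (h1 : r < 1) : Summable (fun n : ℕ => (n : ℝ) * r ^ n) := by
  have := summable_pow_mul_geometric_of_norm_lt_one 1 (r := r) (by rwa [Real.norm_of_nonneg h0])
  simpa using this

lemma VF_summable (q : ℕ) (z : ℂ) (hz : ‖z‖ < 1) :
    Summable (fun n : ℕ => (padicValNat q n : ℂ) * z ^ n) :=
  Summable.of_norm_bounded (summable_nr ‖z‖ (norm_nonneg _) hz) (fun n => VF_bound q n z _ le_rfl)

lemma VF_eq (q : ℕ) (hq : 2 ≤ q) (z : ℂ) (hz : ‖z‖ < 1) :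
    VF q z = VF q (z ^ q) + z ^ q / (1 - z ^ q) := by
  have hzq : ‖z ^ q‖ < 1 := by
    rw [norm_pow]; exact pow_lt_one₀ (norm_nonneg _) hz (by omega)
  have hinj : Function.Injective (fun m : ℕ => q * m) := fun x y h =>
    Nat.eq_of_mul_eq_mul_left (by omega) h
  have e1 : VF q z = ∑' m : ℕ, (padicValNat q (q * m) : ℂ) * z ^ (q * m) := by
    unfold VF
    refine (hinj.tsum_eq (f := fun n : ℕ => (padicValNat q n : ℂ) * z ^ n) ?_).symm
    intro n hn
    by_contra hc
    apply hn
    have : ¬ q ∣ n := fun ⟨m, hm⟩ => hc ⟨m, hm.symm⟩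
    simp [padicValNat.eq_zero_of_not_dvd this]
  have s1 := VF_summable q (z ^ q) hzq
  have s2 := hasSum_geometric_of_norm_lt_one hzq
  have s3 : HasSum (fun m : ℕ => if m = 0 then (0 : ℂ) else (z ^ q) ^ m) (z ^ q / (1 - z ^ q)) := by
    rw [← hasSum_nat_add_iff' 1]
    simp only [Nat.add_eq_zero_iff, one_ne_zero, and_false, if_false, Finset.range_one,
      Finset.sum_singleton, if_true, sub_zero]
    have := s2.mul_left (z ^ q)
    simpa [pow_succ', div_eq_mul_inv] using this
  rw [e1]
  refine (s1.hasSum.add s3).tsum_eq ▸ ?_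
  refine tsum_congr fun m => ?_
  rcases Nat.eq_zero_or_pos m with rfl | hm
  · simp
  · rw [pv_mul q hq m hm, if_neg hm.ne', pow_mul]; push_cast; ring

lemma VF_diff (q : ℕ) : DifferentiableOn ℂ (VF q) (Metric.ball 0 1) := by
  intro z hz
  rw [mem_ball_zero_iff] at hz
  obtain ⟨r, h1, h2⟩ := exists_between hz
  have : DifferentiableOn ℂ (VF q) (Metric.ball 0 r) := by
    refine Complex.differentiableOn_tsum_of_summable_norm
      (summable_nr r ((norm_nonneg _).trans h1.le) h2) ?_ Metric.isOpen_ball ?_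
    · intro i; fun_prop
    · intro i w hw
      exact VF_bound q i w r (mem_ball_zero_iff.1 hw).le
  exact (this.differentiableAt (Metric.isOpen_ball.mem_nhds (mem_ball_zero_iff.2 h1))).differentiableWithinAt

lemma VF_trunc (q M : ℕ) :
    (fun z => VF q z - ∑ n ∈ Finset.range M, (padicValNat q n : ℂ) * z ^ n) =O[𝓝 0]
      (fun z : ℂ => z ^ M) := by
  refine Asymptotics.IsBigO.of_bound (∑' n : ℕ, ((n + M : ℕ) : ℝ) * (1/2) ^ n) ?_
  filter_upwards [Metric.ball_mem_nhds (0 : ℂ) (show (0:ℝ) < 1/2 by norm_num)] with z hz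
  rw [mem_ball_zero_iff] at hz
  have hs := VF_summable q z (by linarith)
  have hs2 : Summable (fun n : ℕ => ((n + M : ℕ) : ℝ) * (1/2 : ℝ) ^ n) := by
    have := (summable_nat_add_iff M).2 (summable_nr (1/2) (by norm_num) (by norm_num))
    refine (this.mul_left (2 ^ M)).congr fun n => ?_
    have h2 : (2 : ℝ) ^ M * (1 / 2) ^ M = 1 := by rw [← mul_pow]; norm_num
    rw [pow_add]; linear_combination ((n + M : ℕ) : ℝ) * (1/2 : ℝ) ^ n * h2
  have : VF q z - ∑ n ∈ Finset.range M, (padicValNat q n : ℂ) * z ^ n =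
      ∑' n : ℕ, (padicValNat q (n + M) : ℂ) * z ^ (n + M) := by
    rw [VF, ← hs.sum_add_tsum_nat_add M]; ring
  rw [this, mul_comm, norm_pow, ← tsum_mul_left]
  refine tsum_of_norm_bounded (hs2.mul_left (‖z‖ ^ M)).hasSum fun n => ?_
  rw [norm_mul, norm_pow, Complex.norm_natCast, pow_add]
  have h1 : (padicValNat q (n + M) : ℝ) ≤ ((n + M : ℕ) : ℝ) := by exact_mod_cast pv_le q _
  calc (padicValNat q (n + M) : ℝ) * (‖z‖ ^ n * ‖z‖ ^ M) ≤ ((n + M : ℕ) : ℝ) * ((1/2) ^ n * ‖z‖ ^ M) := by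
        gcongr
    _ = _ := by ring

lemma VF_re_nonneg (q : ℕ) (r : ℝ) (h0 : 0 ≤ r) (h1 : r < 1) : 0 ≤ (VF q (r : ℂ)).re := by
  rw [VF, Complex.re_tsum (VF_summable q _ (by simpa [abs_of_nonneg h0] using h1))]
  refine tsum_nonneg fun n => ?_
  have : (padicValNat q n : ℂ) * (r : ℂ) ^ n = (((padicValNat q n : ℝ) * r ^ n : ℝ) : ℂ) := by
    push_cast; rfl
  rw [this, Complex.ofReal_re]; positivity

lemma pow_tendsto_lt (q : ℕ) (hq : 2 ≤ q) : Tendsto (fun r : ℝ => r ^ q) (𝓝[<] 1) (𝓝[<] 1) := by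
  refine tendsto_nhdsWithin_iff.2 ⟨?_, ?_⟩
  · have : Tendsto (fun r : ℝ => r ^ q) (𝓝 1) (𝓝 (1 ^ q)) := (continuous_pow q).tendsto 1
    rw [one_pow] at this
    exact this.mono_left nhdsWithin_le_nhds
  · filter_upwards [Ioo_mem_nhdsLT (show (0:ℝ) < 1 by norm_num)] with r hr
    exact pow_lt_one₀ hr.1.le hr.2 (by omega)

lemma VF_atTop (q : ℕ) (hq : 2 ≤ q) (l : ℕ) : ∀ (ζ : ℂ), ζ ^ (q ^ l) = 1 →
    Tendsto (fun r : ℝ => ‖VF q ((r : ℂ) * ζ)‖) (𝓝[<] 1) atTop := by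
  have hbase : Tendsto (fun r : ℝ => ‖VF q (r : ℂ)‖) (𝓝[<] 1) atTop := by
    have h1 : Tendsto (fun s : ℝ => s / (1 - s)) (𝓝[<] 1) atTop := by
      have a1 : Tendsto (fun s : ℝ => (1 - s)⁻¹) (𝓝[<] 1) atTop := by
        refine tendsto_inv_nhdsGT_zero.comp (tendsto_nhdsWithin_iff.2 ⟨?_, ?_⟩)
        · have : Tendsto (fun s : ℝ => 1 - s) (𝓝 1) (𝓝 (1 - 1)) := Continuous.tendsto (by fun_prop) 1
          rw [sub_self] at this
          exact this.mono_left nhdsWithin_le_nhds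
        · filter_upwards [self_mem_nhdsWithin] with r hr
          exact sub_pos.2 (Set.mem_Iio.1 hr)
      have a2 : Tendsto (fun s : ℝ => s) (𝓝[<] 1) (𝓝 1) := nhdsWithin_le_nhds
      exact a2.pos_mul_atTop one_pos a1
    refine tendsto_atTop_mono' _ ?_ (h1.comp (pow_tendsto_lt q hq))
    filter_upwards [Ioo_mem_nhdsLT (show (0:ℝ) < 1 by norm_num)] with r hr
    have hn : ‖(r : ℂ)‖ < 1 := by simpa [abs_of_pos hr.1] using hr.2
    have e : VF q (r : ℂ) = VF q ((r ^ q : ℝ) : ℂ) + ((r ^ q / (1 - r ^ q) : ℝ) : ℂ) := by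
      rw [VF_eq q hq _ hn]; push_cast; rfl
    have h2 := VF_re_nonneg q (r ^ q) (by have := hr.1; positivity) (pow_lt_one₀ hr.1.le hr.2 (by omega))
    refine le_trans ?_ (Complex.re_le_norm _)
    rw [e, Complex.add_re, Complex.ofReal_re]
    simpa using h2
  induction l with
  | zero => intro ζ h; simp at h; subst h; simpa using hbase
  | succ l ih =>
    intro ζ h
    have hζ : ‖ζ‖ = 1 := Complex.norm_eq_one_of_pow_eq_one h (by positivity)
    by_cases h1 : ζ ^ q = 1
    · refine hbase.congr' ?_
      filter_upwards [Ioo_mem_nhdsLT (show (0:ℝ) < 1 by norm_num)] with r hr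
      have hn : ‖(r : ℂ)‖ < 1 := by simpa [abs_of_pos hr.1] using hr.2
      rw [VF_eq q hq _ hn, VF_eq q hq ((r : ℂ) * ζ) (by rw [norm_mul, hζ, mul_one]; exact hn),
        mul_pow, h1, mul_one]
    · have h2 := (ih (ζ ^ q) (by rw [← pow_mul, ← pow_succ']; exact h)).comp (pow_tendsto_lt q hq)
      have h3 : Tendsto (fun r : ℝ => - ‖((r : ℂ) * ζ) ^ q / (1 - ((r : ℂ) * ζ) ^ q)‖) (𝓝[<] 1)
          (𝓝 (- ‖(((1 : ℝ) : ℂ) * ζ) ^ q / (1 - (((1 : ℝ) : ℂ) * ζ) ^ q)‖)) := by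
        refine Tendsto.mono_left ?_ nhdsWithin_le_nhds
        refine ContinuousAt.tendsto (f := fun r : ℝ => - ‖((r : ℂ) * ζ) ^ q / (1 - ((r : ℂ) * ζ) ^ q)‖) ?_
        refine (ContinuousAt.norm (ContinuousAt.div ?_ ?_ ?_)).neg
        · fun_prop
        · fun_prop
        · simpa using sub_ne_zero.2 (Ne.symm h1)
      refine tendsto_atTop_mono' _ ?_ (h2.atTop_add h3)
      filter_upwards [Ioo_mem_nhdsLT (show (0:ℝ) < 1 by norm_num)] with r hr
      have hn : ‖(r : ℂ) * ζ‖ < 1 := by rw [norm_mul, hζ, mul_one]; simpa [abs_of_pos hr.1] using hr.2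
      rw [VF_eq q hq _ hn]
      simp only [Function.comp]
      push_cast
      rw [← mul_pow]
      have := norm_sub_le (VF q (((r:ℂ) * ζ) ^ q) + ((r : ℂ) * ζ) ^ q / (1 - ((r : ℂ) * ζ) ^ q)) (((r : ℂ) * ζ) ^ q / (1 - ((r : ℂ) * ζ) ^ q))
      rw [add_sub_cancel_right] at this
      linarith

lemma VF_transc (q : ℕ) (hq : 2 ≤ q) (A : ℕ → Polynomial ℂ) (n : ℕ) :
    (∀ z : ℂ, ‖z‖ < 1 → ∑ j ∈ Finset.range n, (A j).eval z * VF q z ^ j = 0) →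
    ∀ j < n, A j = 0 := by
  induction n with
  | zero => intro _ j hj; omega
  | succ n ih =>
    intro h
    have key : A n = 0 := by
      apply Polynomial.eq_zero_of_infinite_isRoot
      have hinf : (Set.range (fun l : ℕ => Complex.exp (2 * Real.pi * Complex.I / ((q ^ l : ℕ) : ℂ)))).Infinite := by
        apply Set.infinite_range_of_injective
        intro l m hlm
        have p1 := Complex.isPrimitiveRoot_exp (q ^ l) (by positivity)
        have p2 := Complex.isPrimitiveRoot_exp (q ^ m) (by positivity)
        simp only at hlm
        rw [hlm] at p1
        exact Nat.pow_right_injective hq (p1.unique p2)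
      refine hinf.mono ?_
      rintro _ ⟨l, rfl⟩
      simp only
      set ζ := Complex.exp (2 * Real.pi * Complex.I / ((q ^ l : ℕ) : ℂ)) with hζd
      have hζ1 : ζ ^ (q ^ l) = 1 := (Complex.isPrimitiveRoot_exp (q ^ l) (by positivity)).pow_eq_one
      have hζ : ‖ζ‖ = 1 := Complex.norm_eq_one_of_pow_eq_one hζ1 (by positivity)
      have ht := VF_atTop q hq l ζ hζ1
      have hinv : Tendsto (fun r : ℝ => (VF q ((r : ℂ) * ζ))⁻¹) (𝓝[<] 1) (𝓝 0) := by
        rw [tendsto_zero_iff_norm_tendsto_zero]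
        simp only [norm_inv]
        exact tendsto_inv_atTop_zero.comp ht
      have hA : ∀ j, Tendsto (fun r : ℝ => (A j).eval ((r : ℂ) * ζ)) (𝓝[<] 1) (𝓝 ((A j).eval ζ)) := by
        intro j
        have : Tendsto (fun r : ℝ => (A j).eval ((r : ℂ) * ζ)) (𝓝 1) (𝓝 ((A j).eval (((1:ℝ) : ℂ) * ζ))) :=
          Continuous.tendsto (by fun_prop) 1
        simp only [Complex.ofReal_one, one_mul] at this
        exact this.mono_left nhdsWithin_le_nhds
      have hsum : Tendsto (fun r : ℝ => - ∑ j ∈ Finset.range n,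
          (A j).eval ((r : ℂ) * ζ) * ((VF q ((r : ℂ) * ζ))⁻¹) ^ (n - j)) (𝓝[<] 1) (𝓝 (- ∑ j ∈ Finset.range n, (A j).eval ζ * 0 ^ (n - j))) :=
        (tendsto_finsetSum _ fun j _ => (hA j).mul (hinv.pow _)).neg
      have hz : (- ∑ j ∈ Finset.range n, (A j).eval ζ * 0 ^ (n - j) : ℂ) = 0 := by
        rw [neg_eq_zero]
        refine Finset.sum_eq_zero fun j hj => ?_
        rw [zero_pow (by have := Finset.mem_range.1 hj; omega), mul_zero]
      rw [hz] at hsum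
      refine tendsto_nhds_unique (hA n) (hsum.congr' ?_)
      filter_upwards [Ioo_mem_nhdsLT (show (0:ℝ) < 1 by norm_num), ht.eventually_gt_atTop 0] with r hr h0
      have hn : ‖(r : ℂ) * ζ‖ < 1 := by rw [norm_mul, hζ, mul_one]; simpa [abs_of_pos hr.1] using hr.2
      have h0' := norm_pos_iff.1 h0
      have := h _ hn
      rw [Finset.sum_range_succ] at this
      apply mul_right_cancel₀ (pow_ne_zero n h0')
      rw [eq_neg_of_add_eq_zero_right this, neg_mul, Finset.sum_mul]
      congr 1
      refine Finset.sum_congr rfl fun j hj => ?_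
      have hj := Finset.mem_range.1 hj
      rw [mul_assoc]
      congr 1
      rw [inv_pow, ← Nat.sub_add_cancel hj.le, pow_add, Nat.sub_add_cancel hj.le, inv_mul_cancel_left₀ (pow_ne_zero _ h0')]
    intro j hj
    rcases Nat.lt_succ_iff_lt_or_eq.1 hj with hj | rfl
    · refine ih (fun z hz => ?_) j hj
      have := h z hz
      rw [Finset.sum_range_succ, key] at this
      simpa using this
    · exact key

lemma liou (α : ℂ) (hα : IsAlgebraic ℚ α) : ∃ (n : ℕ) (C0 δ : ℝ), 0 ≤ C0 ∧ 1 ≤ δ ∧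
    ∀ (p : ℕ) (G : Polynomial ℤ) (H : ℝ), 1 ≤ H → G.natDegree ≤ p →
      (∀ y : ℂ, ‖y‖ ≤ C0 → ‖Polynomial.aeval y G‖ ≤ H) → Polynomial.aeval α G ≠ 0 →
      1 ≤ δ ^ (p * n) * ‖Polynomial.aeval α G‖ * H ^ n := by
  classical
  have hint : IsIntegral ℚ α := hα.isIntegral
  have : FiniteDimensional ℚ (IntermediateField.adjoin ℚ {α}) :=
    IntermediateField.adjoin.finiteDimensional hint
  set K := IntermediateField.adjoin ℚ {α}
  set β : K := IntermediateField.AdjoinSimple.gen ℚ α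
  have hβ : ((β : K) : ℂ) = α := IntermediateField.AdjoinSimple.coe_gen ℚ α
  have halgZ : IsAlgebraic ℤ β := by
    rw [IsAlgebraic, ]
    have : IsAlgebraic ℚ β := Algebra.IsAlgebraic.isAlgebraic β
    exact (IsFractionRing.isAlgebraic_iff ℤ ℚ K).2 this
  obtain ⟨y, hy0, hyint⟩ := halgZ.exists_integral_multiple
  set σ0 : K →ₐ[ℚ] ℂ := K.val
  refine ⟨Fintype.card (K →ₐ[ℚ] ℂ), ∑ σ : K →ₐ[ℚ] ℂ, ‖σ β‖, |(y : ℝ)|, ?_, ?_, ?_⟩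
  · positivity
  · exact_mod_cast Int.one_le_abs hy0
  intro p G H hH hdeg hbd hne
  set x : K := (y : K) ^ p * Polynomial.aeval β G with hx
  have hxint : IsIntegral ℤ x := by
    rw [hx, Polynomial.aeval_eq_sum_range' (Nat.lt_succ_of_le hdeg), Finset.mul_sum]
    refine IsIntegral.sum _ fun i hi => ?_
    have hi : i ≤ p := Nat.lt_succ_iff.1 (Finset.mem_range.1 hi)
    have : (y : K) ^ p * G.coeff i • β ^ i = algebraMap ℤ K (y ^ (p - i) * G.coeff i) * (y • β) ^ i := by
      rw [← Nat.sub_add_cancel hi, pow_add, Nat.sub_add_cancel hi]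
      simp only [zsmul_eq_mul, map_mul, map_pow, eq_intCast]
      ring
    rw [this]
    exact isIntegral_algebraMap.mul (hyint.pow i)
  have hσ : ∀ σ : K →ₐ[ℚ] ℂ, σ x = (y : ℂ) ^ p * Polynomial.aeval (σ β) G := by
    intro σ
    rw [hx, map_mul, map_pow, map_intCast]
    congr 1
    exact (Polynomial.aeval_algHom_apply (σ.restrictScalars ℤ) β G).symm
  have hσ0 : σ0 β = α := hβ
  have hx0 : x ≠ 0 := by
    intro h
    have := hσ σ0
    rw [h, map_zero, hσ0] at this
    rcases mul_eq_zero.1 this.symm with h | h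
    · exact hy0 (by by_contra hy; exact pow_ne_zero p (Int.cast_ne_zero.2 hy) h)
    · exact hne h
  have hnint := Algebra.isIntegral_norm ℚ hxint
  obtain ⟨N, hN⟩ := IsIntegrallyClosed.isIntegral_iff.1 hnint
  have hN0 : N ≠ 0 := by
    rintro rfl
    rw [map_zero] at hN
    exact hx0 (Algebra.norm_eq_zero_iff.1 hN.symm)
  have hprod := Algebra.norm_eq_prod_embeddings ℚ ℂ x
  rw [← hN] at hprod
  have h1 : (1 : ℝ) ≤ ‖∏ σ : K →ₐ[ℚ] ℂ, σ x‖ := by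
    rw [← hprod]
    simp only [eq_intCast, map_intCast, Complex.norm_intCast]
    exact_mod_cast Int.one_le_abs hN0
  have hb : ∀ σ : K →ₐ[ℚ] ℂ, ‖Polynomial.aeval (σ β) G‖ ≤ H := fun σ =>
    hbd _ (Finset.single_le_sum (f := fun σ : K →ₐ[ℚ] ℂ => ‖σ β‖) (fun _ _ => norm_nonneg _) (Finset.mem_univ σ))
  refine h1.trans ?_
  rw [norm_prod]
  simp only [hσ, norm_mul, norm_pow, Complex.norm_intCast]
  rw [Finset.prod_mul_distrib, Finset.prod_const, Finset.card_univ, ← pow_mul, mul_assoc]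
  gcongr
  rw [← Finset.mul_prod_erase _ _ (Finset.mem_univ σ0), hσ0]
  gcongr
  calc _ ≤ ∏ σ ∈ Finset.univ.erase σ0, H := Finset.prod_le_prod (fun _ _ => norm_nonneg _) fun σ _ => hb σ
    _ = H ^ (Finset.univ.erase σ0).card := by rw [Finset.prod_const]
    _ ≤ _ := pow_le_pow_right₀ hH (Finset.card_le_univ _)

noncomputable def EE (p : ℕ) (c : ℕ → ℕ → ℤ) (z y : ℂ) : ℂ :=
  ∑ i ∈ Finset.range (p + 1), ∑ j ∈ Finset.range (p + 1), (c i j : ℂ) * z ^ i * y ^ j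

lemma VF_cont0 (q : ℕ) : ContinuousAt (VF q) 0 :=
  ((VF_diff q).differentiableAt (Metric.ball_mem_nhds 0 one_pos)).continuousAt

lemma aux_exists_s6 (q p : ℕ) (hp : 1 ≤ p) : ∃ c : ℕ → ℕ → ℤ, (∃ i ≤ p, ∃ j ≤ p, c i j ≠ 0) ∧
    (fun z => EE p c z (VF q z)) =O[𝓝 0] (fun z : ℂ => z ^ (p * p)) := by
  classical
  set F : Polynomial ℤ := ∑ n ∈ Finset.range (p * p), Polynomial.C (padicValNat q n : ℤ) * Polynomial.X ^ n with hF
  let A : Matrix (Fin (p * p)) (Fin (p + 1) × Fin (p + 1)) ℤ := fun n ij =>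
    (Polynomial.X ^ (ij.1 : ℕ) * F ^ (ij.2 : ℕ)).coeff n
  obtain ⟨t, ht0, hA, -⟩ := Int.Matrix.exists_ne_zero_int_vec_norm_le A
    (by simp; nlinarith) (by simp; omega)
  set c : ℕ → ℕ → ℤ := fun i j => if h : i < p + 1 ∧ j < p + 1 then t (⟨i, h.1⟩, ⟨j, h.2⟩) else 0 with hc
  have hct : ∀ i j : Fin (p + 1), c i j = t (i, j) := by
    intro i j
    exact dif_pos ⟨i.2, j.2⟩
  refine ⟨c, ?_, ?_⟩
  · obtain ⟨⟨i, j⟩, hij⟩ := Function.ne_iff.1 ht0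
    exact ⟨i, by omega, j, by omega, by rw [hct]; exact hij⟩
  set Q : Polynomial ℤ := ∑ i ∈ Finset.range (p + 1), ∑ j ∈ Finset.range (p + 1),
    Polynomial.C (c i j) * (Polynomial.X ^ i * F ^ j) with hQ
  have hdvd : Polynomial.X ^ (p * p) ∣ Q := by
    rw [Polynomial.X_pow_dvd_iff]
    intro n hn
    have := congrFun hA ⟨n, hn⟩
    simp only [Matrix.mulVec, dotProduct, A, Fintype.sum_prod_type, Pi.zero_apply] at this
    rw [hQ]
    simp only [Polynomial.finsetSum_coeff, Polynomial.coeff_C_mul]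
    rw [Finset.sum_range, ← this]
    refine Finset.sum_congr rfl fun i _ => ?_
    rw [Finset.sum_range]
    refine Finset.sum_congr rfl fun j _ => ?_
    rw [hct, mul_comm]
  obtain ⟨R, hR⟩ := hdvd
  have hQe : ∀ z : ℂ, EE p c z (Polynomial.aeval z F) = z ^ (p * p) * Polynomial.aeval z R := by
    intro z
    have := congrArg (Polynomial.aeval z) hR
    rw [map_mul, map_pow, Polynomial.aeval_X] at this
    rw [← this, hQ]
    simp [EE, mul_assoc]
  have hFe : ∀ z : ℂ, Polynomial.aeval z F = ∑ n ∈ Finset.range (p * p), (padicValNat q n : ℂ) * z ^ n := by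
    intro z; simp [hF]
  have hFO : (fun z => VF q z - Polynomial.aeval z F) =O[𝓝 0] (fun z : ℂ => z ^ (p * p)) := by
    simp only [hFe]; exact VF_trunc q (p * p)
  have hone : ∀ g : ℂ → ℂ, ContinuousAt g 0 → g =O[𝓝 0] (fun _ => (1 : ℂ)) := fun g hg =>
    hg.tendsto.isBigO_one ℂ
  have hRc : ContinuousAt (fun z : ℂ => Polynomial.aeval z R) 0 := by fun_prop
  have hFc : ContinuousAt (fun z : ℂ => Polynomial.aeval z F) 0 := by fun_prop
  have h2 : (fun z : ℂ => EE p c z (Polynomial.aeval z F)) =O[𝓝 0] (fun z : ℂ => z ^ (p * p)) := by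
    simp only [hQe]
    simpa using (Asymptotics.isBigO_refl (fun z : ℂ => z ^ (p * p)) (𝓝 0)).mul (hone _ hRc)
  have h1 : (fun z : ℂ => EE p c z (VF q z) - EE p c z (Polynomial.aeval z F)) =O[𝓝 0] (fun z : ℂ => z ^ (p * p)) := by
    simp only [EE, ← Finset.sum_sub_distrib]
    refine Asymptotics.IsBigO.fun_sum fun i _ => Asymptotics.IsBigO.fun_sum fun j _ => ?_
    have e : ∀ z : ℂ, (c i j : ℂ) * z ^ i * VF q z ^ j - (c i j : ℂ) * z ^ i * (Polynomial.aeval z F) ^ j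
      = (VF q z - Polynomial.aeval z F) * ((c i j : ℂ) * z ^ i * ∑ k ∈ Finset.range j, VF q z ^ k * (Polynomial.aeval z F) ^ (j - 1 - k)) := by
      intro z
      rw [← mul_sub, ← (Commute.all (VF q z) (Polynomial.aeval z F)).geom_sum₂_mul]; ring
    simp only [e]
    have hcc : ContinuousAt (fun z : ℂ => ((c i j : ℂ) * z ^ i * ∑ k ∈ Finset.range j, VF q z ^ k * (Polynomial.aeval z F) ^ (j - 1 - k))) 0 := by
      have := VF_cont0 q
      fun_prop
    simpa using hFO.mul (hone _ hcc)
  simpa using h1.add h2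

lemma EE_ne (q p : ℕ) (hq : 2 ≤ q) (c : ℕ → ℕ → ℤ) (hc : ∃ i ≤ p, ∃ j ≤ p, c i j ≠ 0) :
    ∀ᶠ z in 𝓝[≠] (0 : ℂ), EE p c z (VF q z) ≠ 0 := by
  by_contra hcon
  rw [Filter.not_eventually] at hcon
  simp only [not_not] at hcon
  have hd : DifferentiableOn ℂ (fun z => EE p c z (VF q z)) (Metric.ball 0 1) := by
    have := VF_diff q
    unfold EE
    fun_prop
  have hz := (hd.analyticOnNhd Metric.isOpen_ball).eqOn_zero_of_preconnected_of_frequently_eq_zero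
    (convex_ball (0 : ℂ) 1).isPreconnected (Metric.mem_ball_self one_pos) hcon
  obtain ⟨i, hi, j, hj, hij⟩ := hc
  have := VF_transc q hq (fun j => ∑ i ∈ Finset.range (p + 1), Polynomial.C (c i j : ℂ) * Polynomial.X ^ i) (p + 1) (by
    intro z hz1
    have h := hz (mem_ball_zero_iff.2 hz1)
    simp only [EE, Pi.zero_apply] at h
    rw [Finset.sum_comm] at h
    rw [← h]
    refine Finset.sum_congr rfl fun j _ => ?_
    simp [Polynomial.eval_finsetSum, Finset.sum_mul]) j (by omega)
  have h2 := congrArg (fun P => Polynomial.coeff P i) this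
  simp [Polynomial.finsetSum_coeff, Polynomial.coeff_X_pow] at h2
  exact hij (h2 hi)

lemma T_int (q a b : ℕ) (hq : 2 ≤ q) (hab : a < b) (k : ℕ) : ∃ N : ℤ,
    VF q ((a : ℂ) / b) - VF q (((a : ℂ) / b) ^ (q ^ k)) = N / ((b : ℂ) ^ (q ^ k) - (a : ℂ) ^ (q ^ k)) := by
  have hb0 : (b : ℂ) ≠ 0 := by exact_mod_cast (by omega : b ≠ 0)
  have hD : ∀ m : ℕ, m ≠ 0 → (b : ℂ) ^ m - (a : ℂ) ^ m ≠ 0 := by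
    intro m hm h
    have : b ^ m = a ^ m := by exact_mod_cast sub_eq_zero.1 h
    exact absurd this (Nat.pow_lt_pow_left hab hm).ne'
  have hn : ‖(a : ℂ) / b‖ < 1 := by
    rw [norm_div, Complex.norm_natCast, Complex.norm_natCast, div_lt_one (by exact_mod_cast (by omega : 0 < b))]
    exact_mod_cast hab
  induction k with
  | zero => exact ⟨0, by simp⟩
  | succ k ih =>
    obtain ⟨N, hN⟩ := ih
    have hdv : ((b : ℤ) ^ (q ^ k) - (a : ℤ) ^ (q ^ k)) ∣ ((b : ℤ) ^ (q ^ (k + 1)) - (a : ℤ) ^ (q ^ (k + 1))) := by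
      rw [pow_succ q k, pow_mul, pow_mul]; exact sub_dvd_pow_sub_pow _ _ _
    obtain ⟨e, he⟩ := hdv
    have he' : (b : ℂ) ^ (q ^ (k + 1)) - (a : ℂ) ^ (q ^ (k + 1)) = ((b : ℂ) ^ (q ^ k) - (a : ℂ) ^ (q ^ k)) * e := by
      exact_mod_cast he
    have hq0 : ∀ k, q ^ k ≠ 0 := fun k => by positivity
    have h1 := VF_eq q hq (((a : ℂ) / b) ^ (q ^ k)) (by rw [norm_pow]; exact pow_lt_one₀ (norm_nonneg _) hn (hq0 k))
    rw [← pow_mul, ← pow_succ] at h1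
    refine ⟨N * e + (a : ℤ) ^ (q ^ (k + 1)), ?_⟩
    have h2 : ((a : ℂ) / b) ^ (q ^ (k + 1)) / (1 - ((a : ℂ) / b) ^ (q ^ (k + 1))) = (a : ℂ) ^ (q ^ (k + 1)) / ((b : ℂ) ^ (q ^ (k + 1)) - (a : ℂ) ^ (q ^ (k + 1))) := by
      have := pow_ne_zero (q ^ (k + 1)) hb0
      rw [div_pow, one_sub_div this, div_div_div_cancel_right₀ this]
    have h3 : (N : ℂ) / ((b : ℂ) ^ (q ^ k) - (a : ℂ) ^ (q ^ k)) = N * e / ((b : ℂ) ^ (q ^ (k + 1)) - (a : ℂ) ^ (q ^ (k + 1))) := by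
      have hD1 := hD _ (hq0 (k + 1))
      rw [he'] at hD1 ⊢
      rw [mul_div_mul_right _ _ (right_ne_zero_of_mul hD1)]
    rw [h1, h2, h3] at hN
    push_cast
    rw [add_div]
    linear_combination hN

noncomputable def GG (p : ℕ) (c : ℕ → ℕ → ℤ) (A B D N : ℤ) : Polynomial ℤ :=
  ∑ i ∈ Finset.range (p + 1), ∑ j ∈ Finset.range (p + 1),
    Polynomial.C (c i j * A ^ i * B ^ (p - i) * D ^ (p - j)) *
      (Polynomial.C D * Polynomial.X - Polynomial.C N) ^ j

lemma GG_deg (p : ℕ) (c : ℕ → ℕ → ℤ) (A B D N : ℤ) : (GG p c A B D N).natDegree ≤ p := by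
  refine Polynomial.natDegree_sum_le_of_forall_le _ _ fun i _ =>
    Polynomial.natDegree_sum_le_of_forall_le _ _ fun j hj => ?_
  refine (Polynomial.natDegree_C_mul_le _ _).trans ?_
  refine (Polynomial.natDegree_pow_le).trans ?_
  have h1 : (Polynomial.C D * Polynomial.X - Polynomial.C N).natDegree ≤ 1 := by
    compute_degree
  have := Finset.mem_range.1 hj
  nlinarith

lemma GG_eval (p : ℕ) (c : ℕ → ℕ → ℤ) (A B D N : ℤ) (hB : B ≠ 0) (hD : D ≠ 0) (y : ℂ) :
    Polynomial.aeval y (GG p c A B D N) =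
      (B : ℂ) ^ p * (D : ℂ) ^ p * EE p c ((A : ℂ) / B) (y - N / D) := by
  have hB' : (B : ℂ) ≠ 0 := by exact_mod_cast hB
  have hD' : (D : ℂ) ≠ 0 := by exact_mod_cast hD
  simp only [GG, EE, map_sum, Finset.mul_sum]
  refine Finset.sum_congr rfl fun i hi => Finset.sum_congr rfl fun j hj => ?_
  have hi := Finset.mem_range.1 hi
  have hj := Finset.mem_range.1 hj
  have e1 : (B : ℂ) ^ p = B ^ (p - i) * B ^ i := by rw [← pow_add]; congr 1; omega
  have e2 : (D : ℂ) ^ p = D ^ (p - j) * D ^ j := by rw [← pow_add]; congr 1; omega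
  have e3 : (D : ℂ) * y - N = D * (y - N / D) := by field_simp
  simp only [map_mul, map_pow, map_sub, Polynomial.aeval_C, Polynomial.aeval_X, eq_intCast,
    map_intCast]
  rw [e3, e1, e2, mul_pow, div_pow]
  field_simp

lemma EE_bound (p : ℕ) (c : ℕ → ℕ → ℤ) (z y : ℂ) (Y : ℝ) (hz : ‖z‖ ≤ 1) (hy : ‖y‖ ≤ Y) :
    ‖EE p c z y‖ ≤ ∑ i ∈ Finset.range (p + 1), ∑ j ∈ Finset.range (p + 1), |(c i j : ℝ)| * Y ^ j := by
  refine norm_sum_le_of_le _ fun i _ => norm_sum_le_of_le _ fun j _ => ?_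
  rw [norm_mul, norm_mul, norm_pow, norm_pow, Complex.norm_intCast]
  have : ‖z‖ ^ i ≤ 1 := pow_le_one₀ (norm_nonneg _) hz
  calc |(c i j : ℝ)| * ‖z‖ ^ i * ‖y‖ ^ j ≤ |(c i j : ℝ)| * 1 * Y ^ j := by gcongr
    _ = _ := by ring

lemma main_rat (q a b : ℕ) (hq : 2 ≤ q) (ha : 0 < a) (hab : a < b) :
    ¬ IsAlgebraic ℚ (VF q ((a : ℂ) / b)) := by
  intro halg
  obtain ⟨n, C0, δ, hC0, hδ, hL⟩ := liou _ halg
  set α := VF q ((a : ℂ) / b) with hα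
  set x : ℝ := (a : ℝ) / b with hx
  have hbpos : (0 : ℝ) < b := by exact_mod_cast (by omega : 0 < b)
  have hb1 : (1 : ℝ) ≤ b := by exact_mod_cast (by omega : 1 ≤ b)
  have hapos : (0 : ℝ) < a := by exact_mod_cast ha
  have hx0 : 0 < x := by positivity
  have hx1 : x < 1 := by rw [hx, div_lt_one hbpos]; exact_mod_cast hab
  -- choose p
  obtain ⟨p, hp1, hp⟩ : ∃ p : ℕ, 1 ≤ p ∧ (b : ℝ) ^ (2 * (n + 1)) * x ^ p < 1 := by
    have ht : Tendsto (fun p : ℕ => (b : ℝ) ^ (2 * (n + 1)) * x ^ p) atTop (𝓝 ((b : ℝ) ^ (2 * (n + 1)) * 0)) :=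
      (tendsto_pow_atTop_nhds_zero_of_lt_one hx0.le hx1).const_mul _
    rw [mul_zero] at ht
    obtain ⟨p, h1, h2⟩ := ((ht.eventually_lt_const one_pos).and (eventually_ge_atTop 1)).exists
    exact ⟨p, h2, h1⟩
  set θ : ℝ := ((b : ℝ) ^ (2 * (n + 1)) * x ^ p) ^ p with hθ
  have hθ0 : 0 ≤ θ := by positivity
  have hθ1 : θ < 1 := pow_lt_one₀ (by positivity) hp (by omega)
  obtain ⟨c, hc, hO⟩ := aux_exists_s6 q p hp1
  have hne := EE_ne q p hq c hc
  obtain ⟨C1, hC1, hO⟩ := hO.exists_pos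
  have hO := hO.bound
  -- the sequence
  have hQ : Tendsto (fun k : ℕ => q ^ k) atTop atTop :=
    tendsto_pow_atTop_atTop_of_one_lt (by omega)
  have hxn : ‖(a : ℂ) / b‖ = x := by
    rw [norm_div, Complex.norm_natCast, Complex.norm_natCast]
  have hxk0 : Tendsto (fun k : ℕ => ((a : ℂ) / b) ^ (q ^ k)) atTop (𝓝 0) :=
    (tendsto_pow_atTop_nhds_zero_of_norm_lt_one (by rw [hxn]; exact hx1)).comp hQ
  have hane : (a : ℂ) / b ≠ 0 := by
    rw [← norm_ne_zero_iff, hxn]; exact hx0.ne'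
  have hxk : Tendsto (fun k : ℕ => ((a : ℂ) / b) ^ (q ^ k)) atTop (𝓝[≠] 0) :=
    tendsto_nhdsWithin_iff.2 ⟨hxk0, Eventually.of_forall fun k => pow_ne_zero _ hane⟩
  set B : ℝ := ‖VF q 0‖ + 1 with hB
  have hVb : ∀ᶠ z in 𝓝 (0 : ℂ), ‖VF q z‖ ≤ B := by
    have := (VF_cont0 q).norm.tendsto.eventually_le_const (show ‖VF q 0‖ < B by rw [hB]; linarith)
    exact this
  set Y : ℝ := C0 + (‖α‖ + B) with hY
  set K : ℝ := ∑ i ∈ Finset.range (p + 1), ∑ j ∈ Finset.range (p + 1), |(c i j : ℝ)| * Y ^ j with hK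
  have hB0 : 0 ≤ B := by positivity
  have hY0 : 0 ≤ Y := by positivity
  have hK0 : 0 ≤ K := by positivity
  set M : ℝ := δ ^ (p * n) * C1 * (K + 1) ^ n with hM
  have hfin : ∀ᶠ k : ℕ in atTop, 1 ≤ M * θ ^ (q ^ k) := by
    filter_upwards [hxk.eventually hne, hxk0.eventually hO, hxk0.eventually hVb] with k h1 h2 h3
    obtain ⟨N, hN⟩ := T_int q a b hq hab k
    set Q := q ^ k with hQd
    have hQ0 : Q ≠ 0 := by positivity
    have hlt : a ^ Q < b ^ Q := Nat.pow_lt_pow_left hab hQ0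
    have hDpos : (0 : ℤ) < (b : ℤ) ^ Q - (a : ℤ) ^ Q := by
      have : ((a ^ Q : ℕ) : ℤ) < ((b ^ Q : ℕ) : ℤ) := by exact_mod_cast hlt
      push_cast at this; linarith
    set D : ℤ := (b : ℤ) ^ Q - (a : ℤ) ^ Q with hD
    have hDc : (D : ℂ) = (b : ℂ) ^ Q - (a : ℂ) ^ Q := by rw [hD]; push_cast; rfl
    rw [← hDc, ← hα] at hN
    have hDle : ‖(D : ℂ)‖ ≤ (b : ℝ) ^ Q := by
      rw [Complex.norm_intCast, abs_of_pos (by exact_mod_cast hDpos), hD]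
      push_cast
      have : (0 : ℝ) ≤ (a : ℝ) ^ Q := by positivity
      linarith
    have hBne : ((b : ℤ) ^ Q) ≠ 0 := pow_ne_zero _ (by omega)
    have hev := GG_eval p c ((a : ℤ) ^ Q) ((b : ℤ) ^ Q) D N hBne hDpos.ne'
    have hxe : (((a : ℤ) ^ Q : ℤ) : ℂ) / (((b : ℤ) ^ Q : ℤ) : ℂ) = ((a : ℂ) / b) ^ Q := by
      push_cast; rw [div_pow]
    rw [hxe] at hev
    set G := GG p c ((a : ℤ) ^ Q) ((b : ℤ) ^ Q) D N with hG
    set z : ℂ := ((a : ℂ) / b) ^ Q with hz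
    have hpre : ‖(((b : ℤ) ^ Q : ℤ) : ℂ) ^ p * (D : ℂ) ^ p‖ ≤ (b : ℝ) ^ (2 * p * Q) := by
      rw [norm_mul, norm_pow, norm_pow]
      have : ‖(((b : ℤ) ^ Q : ℤ) : ℂ)‖ = (b : ℝ) ^ Q := by
        push_cast; rw [norm_pow, Complex.norm_natCast]
      rw [this]
      calc ((b : ℝ) ^ Q) ^ p * ‖(D : ℂ)‖ ^ p ≤ ((b : ℝ) ^ Q) ^ p * ((b : ℝ) ^ Q) ^ p := by gcongr
        _ = _ := by rw [← pow_mul, ← pow_add]; congr 1; ring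
    have hzn : ‖z‖ = x ^ Q := by rw [hz, norm_pow, hxn]
    have hz1 : ‖z‖ ≤ 1 := by rw [hzn]; exact pow_le_one₀ hx0.le hx1.le
    have hαT : α - N / D = VF q z := by rw [← hN]; ring
    have hT : ‖(N : ℂ) / D‖ ≤ ‖α‖ + B := by
      rw [← hN]; exact (norm_sub_le _ _).trans (by gcongr)
    have hbp : (1 : ℝ) ≤ (b : ℝ) ^ (2 * p * Q) := one_le_pow₀ hb1
    have hGα : Polynomial.aeval α G = (((b : ℤ) ^ Q : ℤ) : ℂ) ^ p * (D : ℂ) ^ p * EE p c z (VF q z) := by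
      rw [hev, hαT]
    have key := hL p G ((b : ℝ) ^ (2 * p * Q) * (K + 1)) (one_le_mul_of_one_le_of_one_le hbp (by linarith))
      (GG_deg _ _ _ _ _ _) (by
        intro y hy
        rw [hev, norm_mul]
        have := EE_bound p c z (y - N / D) Y hz1 ((norm_sub_le _ _).trans (by rw [hY]; gcongr))
        rw [← hK] at this
        gcongr
        linarith) (by
        rw [hGα]
        refine mul_ne_zero (mul_ne_zero (pow_ne_zero _ ?_) (pow_ne_zero _ ?_)) h1
        · exact_mod_cast hBne
        · exact_mod_cast hDpos.ne')
    refine key.trans ?_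
    have hGn : ‖Polynomial.aeval α G‖ ≤ (b : ℝ) ^ (2 * p * Q) * (C1 * (x ^ Q) ^ (p * p)) := by
      rw [hGα, norm_mul]
      rw [norm_pow, hzn] at h2
      gcongr
    have hδ0 : 0 ≤ δ := by linarith
    calc δ ^ (p * n) * ‖Polynomial.aeval α G‖ * ((b : ℝ) ^ (2 * p * Q) * (K + 1)) ^ n
        ≤ δ ^ (p * n) * ((b : ℝ) ^ (2 * p * Q) * (C1 * (x ^ Q) ^ (p * p))) * ((b : ℝ) ^ (2 * p * Q) * (K + 1)) ^ n := by
          gcongr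
      _ = M * θ ^ Q := by
          rw [hM, hθ, mul_pow _ (K + 1) n]
          ring
  have hlim : Tendsto (fun k : ℕ => M * θ ^ (q ^ k)) atTop (𝓝 (M * 0)) :=
    ((tendsto_pow_atTop_nhds_zero_of_lt_one hθ0 hθ1).comp hQ).const_mul _
  rw [mul_zero] at hlim
  obtain ⟨k, h1, h2⟩ := (hfin.and (hlim.eventually_lt_const one_pos)).exists
  linarith

lemma VF_alg (q : ℕ) (hq : 2 ≤ q) (l : ℕ) : ∀ z : ℂ, ‖z‖ < 1 → IsAlgebraic ℚ z →
    IsAlgebraic ℚ (VF q z) → IsAlgebraic ℚ (VF q (z ^ (q ^ l))) := by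
  induction l with
  | zero => intro z _ _ h; simpa using h
  | succ l ih =>
    intro z hz ha h
    rw [pow_succ', pow_mul]
    refine ih (z ^ q) (by rw [norm_pow]; exact pow_lt_one₀ (norm_nonneg _) hz (by omega)) (ha.pow q) ?_
    have e : VF q (z ^ q) = VF q z - z ^ q * (1 - z ^ q)⁻¹ := by
      rw [VF_eq q hq z hz]; ring
    rw [e]
    exact h.sub ((ha.pow q).mul (isAlgebraic_one.sub (ha.pow q)).inv)

/-- Let `a`, `b` be relatively prime positive integers with `a/b < 1` and let
`q ≥ 2` be an integer with `q > 2·log b / (log b − log a)`. Let `ℓ ≥ 1` and `0 ≤ h ≤ q^ℓ − 1`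
be integers and set `ω = exp(2πih/q^ℓ)`. Then the complex number
`V_q(ω·a/b) = ∑_{n ≥ 1} ν_q(n)·(ω·a/b)ⁿ` is transcendental over `ℚ`. -/
theorem Vq_root_of_unity_value_transcendental (q a b h ℓ : ℕ) (hq : 2 ≤ q)
    (ha : 0 < a) (hb : 0 < b) (hab : Nat.Coprime a b) (hlt : (a : ℝ) / b < 1)
    (hcond : 2 * Real.log b / (Real.log b - Real.log a) < q)
    (hℓ : 1 ≤ ℓ) (hh : h ≤ q ^ ℓ - 1) :
    Transcendental ℚ (∑' n : ℕ, (padicValNat q n : ℂ) *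
      (Complex.exp (2 * Real.pi * Complex.I * h / (q : ℂ) ^ ℓ) * ((a : ℂ) / b)) ^ n) := by
  intro halg
  set ω := Complex.exp (2 * Real.pi * Complex.I * h / (q : ℂ) ^ ℓ) with hω
  have hq0 : (q : ℂ) ^ ℓ ≠ 0 := pow_ne_zero _ (by exact_mod_cast (by omega : q ≠ 0))
  have hω1 : ω ^ (q ^ ℓ) = 1 := by
    rw [hω, ← Complex.exp_nat_mul]
    have : ((q ^ ℓ : ℕ) : ℂ) * (2 * Real.pi * Complex.I * h / (q : ℂ) ^ ℓ) = h * (2 * Real.pi * Complex.I) := by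
      push_cast; field_simp
    rw [this]
    exact Complex.exp_nat_mul_two_pi_mul_I h
  have hqp : q ^ ℓ ≠ 0 := by positivity
  have hωn : ‖ω‖ = 1 := Complex.norm_eq_one_of_pow_eq_one hω1 hqp
  have hωa : IsAlgebraic ℚ ω :=
    (IsIntegral.of_pow (Nat.pos_of_ne_zero hqp) (by rw [hω1]; exact isIntegral_one)).isAlgebraic
  have hbpos : (0 : ℝ) < b := by exact_mod_cast hb
  have hab' : a < b := by
    rw [div_lt_one hbpos] at hlt
    exact_mod_cast hlt
  have hra : IsAlgebraic ℚ ((a : ℂ) / b) := by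
    rw [div_eq_mul_inv]
    exact (isAlgebraic_natCast a).mul (isAlgebraic_natCast b).inv
  have hn : ‖ω * ((a : ℂ) / b)‖ < 1 := by
    rw [norm_mul, hωn, one_mul, norm_div, Complex.norm_natCast, Complex.norm_natCast]; exact hlt
  have := VF_alg q hq ℓ (ω * ((a : ℂ) / b)) hn (hωa.mul hra) halg
  rw [mul_pow, hω1, one_mul, div_pow] at this
  refine main_rat q (a ^ q ^ ℓ) (b ^ q ^ ℓ) hq (by positivity) (Nat.pow_lt_pow_left hab' hqp) ?_
  push_cast
  exact this
end
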